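/- arXiv:1101.5001 — 6 statements merged into one kernel-verified Lean document; each statement's English description precedes it below -/
import Mathlib

section
/- Let $h$ be a positive integer, $\alpha$ a positive real and $A$, $B$ finite non-empty sets in a commutative group with $|A| = m$ and $|A+B| \le \alpha m$. Then $|A + hB| \le \alpha^h \, m^{2 - 1/h}$ (where $m^{2-1/h}$ denotes the real power). -/
open Pointwise

/-- `iterSum B k` is the `k`-fold iterated sumset `B + ⋯ + B` (`k` times),
with the convention `iterSum B 0 = {0}`. -/
def iterSum {G : Type*} [AddCommGroup G] [DecidableEq G] (B : Finset G) : ℕ → Finset G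
  | 0 => {0}
  | k + 1 => iterSum B k + B

section Plunnecke

variable {G : Type*} [AddCommGroup G] [DecidableEq G]

theorem card_add_iterSum_mul_pow_le {X B : Finset G}
    (hX : ∀ Y ⊆ X, (X + B).card * Y.card ≤ (Y + B).card * X.card) (n : ℕ) :
    (X + iterSum B n).card * X.card ^ n ≤ (X + B).card ^ n * X.card := by
  induction n with
  | zero => simp [iterSum]
  | succ n ih =>
    have key := Finset.pluennecke_petridis_inequality_add (iterSum B n) hX
    calc (X + iterSum B (n + 1)).card * X.card ^ (n + 1)
        = (iterSum B n + X + B).card * X.card * X.card ^ n := by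
          rw [iterSum, add_left_comm, ← add_assoc (iterSum B n), pow_succ]; ring
      _ ≤ (X + B).card * (iterSum B n + X).card * X.card ^ n := Nat.mul_le_mul_right _ key
      _ = (X + B).card * ((X + iterSum B n).card * X.card ^ n) := by
          rw [add_comm X (iterSum B n), mul_assoc]
      _ ≤ (X + B).card * ((X + B).card ^ n * X.card) := Nat.mul_le_mul_left _ ih
      _ = (X + B).card ^ (n + 1) * X.card := by ring

/-- Plünnecke's inequality for a suitable nonempty subset. -/
theorem exists_subset_card_add_iterSum_mul_pow_le {A : Finset G} (hA : A.Nonempty)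
    (B : Finset G) (n : ℕ) :
    ∃ X ⊆ A, X.Nonempty ∧
      (X + iterSum B n).card * A.card ^ n ≤ (A + B).card ^ n * X.card := by
  obtain ⟨X, hX, hmin⟩ := Finset.exists_min_image (A.powerset.erase ∅)
    (fun U ↦ ((U + B).card / U.card : ℚ)) ⟨A, by simp [hA.ne_empty]⟩
  rw [Finset.mem_erase, Finset.mem_powerset, ← Finset.nonempty_iff_ne_empty] at hX
  obtain ⟨hX, hXA⟩ := hX
  have hmin' : ∀ Y ⊆ A, (X + B).card * Y.card ≤ (Y + B).card * X.card := by
    intro Y hY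
    obtain rfl | hY' := Y.eq_empty_or_nonempty
    · simp
    have := hmin Y (by simp [hY'.ne_empty, hY])
    rw [div_le_div_iff₀ (mod_cast hX.card_pos) (mod_cast hY'.card_pos)] at this
    exact_mod_cast this
  refine ⟨X, hXA, hX, ?_⟩
  refine Nat.le_of_mul_le_mul_right ?_ (pow_pos hX.card_pos n)
  calc (X + iterSum B n).card * A.card ^ n * X.card ^ n
      = (X + iterSum B n).card * X.card ^ n * A.card ^ n := by ring
    _ ≤ (X + B).card ^ n * X.card * A.card ^ n := Nat.mul_le_mul_right _
        (card_add_iterSum_mul_pow_le (fun Y hY ↦ hmin' Y (hY.trans hXA)) n)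
    _ = ((X + B).card * A.card) ^ n * X.card := by ring
    _ ≤ ((A + B).card * X.card) ^ n * X.card :=
        Nat.mul_le_mul_right _ (Nat.pow_le_pow_left (hmin' A subset_rfl) n)
    _ = (A + B).card ^ n * X.card * X.card ^ n := by ring

theorem card_iterSum_mul_pow_le {A : Finset G} (hA : A.Nonempty) (B : Finset G) (n : ℕ) :
    (iterSum B n).card * A.card ^ n ≤ (A + B).card ^ n * A.card := by
  obtain ⟨X, hXA, hX, h⟩ := exists_subset_card_add_iterSum_mul_pow_le hA B n
  calc (iterSum B n).card * A.card ^ n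
      ≤ (X + iterSum B n).card * A.card ^ n :=
        Nat.mul_le_mul_right _ (Finset.card_le_card_add_left hX)
    _ ≤ (A + B).card ^ n * X.card := h
    _ ≤ (A + B).card ^ n * A.card := Nat.mul_le_mul_left _ (Finset.card_le_card hXA)

end Plunnecke

theorem harmonic_add_div_le (p x : ℕ) :
    (harmonic p : ℝ) + x / (p + x : ℕ) ≤ harmonic (p + x) := by
  have h : (x : ℚ) / (p + x : ℕ) ≤ ∑ i ∈ Finset.range x, ((p + i + 1 : ℕ) : ℚ)⁻¹ := by
    have := Finset.card_nsmul_le_sum (Finset.range x)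
      (fun i ↦ ((p + i + 1 : ℕ) : ℚ)⁻¹) (((p + x : ℕ) : ℚ)⁻¹) fun i hi ↦ by
        rw [Finset.mem_range] at hi
        exact inv_anti₀ (by positivity) (by exact_mod_cast (by omega : p + i + 1 ≤ p + x))
    simpa [div_eq_mul_inv] using this
  have : harmonic p + x / (p + x : ℕ) ≤ harmonic (p + x) := by
    simp only [harmonic, Finset.sum_range_add]
    simpa using h
  simpa using (Rat.cast_le (K := ℝ)).2 this

theorem le_of_forall_pow_le_pow_mul_linear {x y L : ℝ} (hy : 0 < y)
    (h : ∀ k : ℕ, x ^ k ≤ y ^ k * (1 + k * L)) : x ≤ y := by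
  by_contra! hxy
  have hr : 1 < x / y := (one_lt_div hy).2 hxy
  have h0 := tendsto_pow_const_div_const_pow_of_one_lt 0 hr
  have h1 := (tendsto_pow_const_div_const_pow_of_one_lt 1 hr).mul_const L
  have hlim := h0.add h1
  rw [zero_mul, zero_add] at hlim
  refine absurd (ge_of_tendsto' hlim fun k ↦ ?_) (not_le.2 (zero_lt_one (α := ℝ)))
  have hk : 0 < (x / y) ^ k := by positivity
  rw [pow_zero, pow_one, div_mul_eq_mul_div, ← add_div, le_div_iff₀ hk, one_mul, div_pow,
    div_le_iff₀ (pow_pos hy k), mul_comm]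
  exact h k

section Ruzsa

variable {G : Type*} [AddCommGroup G] [DecidableEq G]

theorem card_add_iterSum_le_mul_harmonic {h : ℕ} (hh : 0 < h) {α c : ℝ} (hα : 0 ≤ α) (hc : 0 ≤ c)
    {A B : Finset G} (hA : A.Nonempty) (hAB : ((A + B).card : ℝ) ≤ α * A.card)
    (hch : c ^ h = (α ^ h * A.card) ^ (h - 1) * (α * A.card) ^ h) :
    ((A + iterSum B h).card : ℝ) ≤ c * harmonic A.card := by
  have hm : (0 : ℝ) < A.card := mod_cast hA.card_pos
  have hB : ((iterSum B h).card : ℝ) ≤ α ^ h * A.card := by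
    have key : ((iterSum B h).card : ℝ) * A.card ^ h ≤ (A + B).card ^ h * A.card := by
      exact_mod_cast card_iterSum_mul_pow_le hA B h
    refine le_of_mul_le_mul_right (key.trans ?_) (pow_pos hm h)
    calc ((A + B).card : ℝ) ^ h * A.card ≤ (α * A.card) ^ h * A.card := by gcongr
      _ = _ := by ring
  suffices H : ∀ n, ∀ S ⊆ A, S.card = n → ((S + iterSum B h).card : ℝ) ≤ c * harmonic n from
    H _ A subset_rfl rfl
  intro n
  induction n using Nat.strong_induction_on with
  | _ n ih =>
  intro S hSA hSn
  obtain rfl | hS := S.eq_empty_or_nonempty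
  · subst hSn; simp
  have hn : (0 : ℝ) < n := by rw [← hSn]; exact_mod_cast hS.card_pos
  obtain ⟨X, hXS, hX, hXh⟩ := exists_subset_card_add_iterSum_mul_pow_le hS B h
  have hx : (0 : ℝ) < X.card := mod_cast hX.card_pos
  have hXB : ((X + iterSum B h).card : ℝ) ≤ X.card * (α ^ h * A.card) := by
    calc ((X + iterSum B h).card : ℝ) ≤ X.card * (iterSum B h).card := by
          exact_mod_cast Finset.card_add_le
      _ ≤ _ := by gcongr
  have hXP : ((X + iterSum B h).card : ℝ) * n ^ h ≤ (α * A.card) ^ h * X.card := by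
    rw [hSn] at hXh
    calc ((X + iterSum B h).card : ℝ) * n ^ h ≤ (S + B).card ^ h * X.card := by
          exact_mod_cast hXh
      _ ≤ (A + B).card ^ h * X.card := by gcongr
      _ ≤ _ := by gcongr
  have hXc : ((X + iterSum B h).card : ℝ) ≤ c * (X.card / n) := by
    rw [mul_div_assoc', le_div_iff₀ hn]
    refine le_of_pow_le_pow_left₀ hh.ne' (by positivity) ?_
    obtain ⟨k, rfl⟩ : ∃ k, h = k + 1 := ⟨h - 1, by omega⟩
    set N : ℝ := ((X + iterSum B (k + 1)).card : ℝ)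
    rw [mul_pow c, hch, Nat.add_sub_cancel]
    calc (N * n) ^ (k + 1) = N ^ k * (N * n ^ (k + 1)) := by ring
      _ ≤ (X.card * (α ^ (k + 1) * A.card)) ^ k * ((α * A.card) ^ (k + 1) * X.card) := by
          gcongr
      _ = _ := by ring
  have hcard : (S \ X).card + X.card = n := hSn ▸ Finset.card_sdiff_add_card_eq_card hXS
  have hrest := ih (S \ X).card (by have := hX.card_pos; omega) (S \ X)
    (Finset.sdiff_subset.trans hSA) rfl
  have hharm := harmonic_add_div_le (S \ X).card X.card
  rw [hcard] at hharm
  calc ((S + iterSum B h).card : ℝ)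
      = (((S \ X) + iterSum B h) ∪ (X + iterSum B h)).card := by
        rw [← Finset.union_add, Finset.sdiff_union_of_subset hXS]
    _ ≤ ((S \ X) + iterSum B h).card + (X + iterSum B h).card := by
        exact_mod_cast Finset.card_union_le _ _
    _ ≤ c * harmonic (S \ X).card + c * (X.card / n) := add_le_add hrest hXc
    _ = c * (harmonic (S \ X).card + X.card / n) := by ring
    _ ≤ c * harmonic n := by gcongr

/-- The desired bound up to a logarithmic factor. -/
theorem card_add_iterSum_le_mul_log {h : ℕ} (hh : 0 < h) {α : ℝ} (hα : 0 < α)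
    {A B : Finset G} (hA : A.Nonempty) (hAB : ((A + B).card : ℝ) ≤ α * A.card) :
    ((A + iterSum B h).card : ℝ) ≤
      α ^ h * (A.card : ℝ) ^ (2 - 1 / (h : ℝ)) * (1 + Real.log A.card) := by
  have hm : (0 : ℝ) < A.card := mod_cast hA.card_pos
  have hpow : ((A.card : ℝ) ^ (2 - 1 / (h : ℝ))) ^ h = (A.card : ℝ) ^ (h - 1) * A.card ^ h := by
    have hh' : (h : ℝ) ≠ 0 := by exact_mod_cast hh.ne'
    rw [← Real.rpow_mul_natCast hm.le, ← pow_add, ← Real.rpow_natCast]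
    congr 1
    rw [Nat.cast_add, Nat.cast_sub hh]
    field_simp
    push_cast
    ring
  refine (card_add_iterSum_le_mul_harmonic (c := α ^ h * (A.card : ℝ) ^ (2 - 1 / (h : ℝ))) hh
    hα.le (by positivity) hA hAB ?_).trans ?_
  · obtain ⟨k, rfl⟩ : ∃ k, h = k + 1 := ⟨h - 1, by omega⟩
    rw [mul_pow, hpow, Nat.add_sub_cancel]
    ring
  · gcongr
    exact harmonic_le_one_add_log _

theorem iterSum_piFinset_const (B : Finset G) (k n : ℕ) :
    iterSum (Fintype.piFinset fun _ : Fin k ↦ B) n =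
      Fintype.piFinset fun _ : Fin k ↦ iterSum B n := by
  induction n with
  | zero => ext f; simp [iterSum, funext_iff]
  | succ n ih => simp only [iterSum, ih, Fintype.piFinset_add]

end Ruzsa

/-- Ruzsa's bound: if `|A| = m` and `|A+B| ≤ α m` then `|A + hB| ≤ α^h m^(2 - 1/h)`. -/
theorem stmt_0 {G : Type*} [AddCommGroup G] [DecidableEq G]
    (h : ℕ) (hh : 0 < h) (α : ℝ) (hα : 0 < α)
    (A B : Finset G) (hA : A.Nonempty) (hB : B.Nonempty)
    (m : ℕ) (hm : A.card = m)
    (hAB : ((A + B).card : ℝ) ≤ α * m) :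
    ((A + iterSum B h).card : ℝ) ≤ α ^ h * (m : ℝ) ^ (2 - 1 / (h : ℝ)) := by
  subst hm
  have hm : (0 : ℝ) < A.card := mod_cast hA.card_pos
  refine le_of_forall_pow_le_pow_mul_linear (L := Real.log A.card) (by positivity) fun k ↦ ?_
  have key := card_add_iterSum_le_mul_log (G := Fin k → G) hh (pow_pos hα k)
    (A := Fintype.piFinset fun _ ↦ A) (B := Fintype.piFinset fun _ ↦ B)
    (Fintype.piFinset_nonempty.2 fun _ ↦ hA) (by
      rw [← Fintype.piFinset_add, Fintype.card_piFinset_const, Fintype.card_piFinset_const]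
      push_cast
      rw [← mul_pow]
      gcongr)
  rw [iterSum_piFinset_const, ← Fintype.piFinset_add, Fintype.card_piFinset_const,
    Fintype.card_piFinset_const] at key
  push_cast at key
  rw [Real.log_pow, ← Real.rpow_pow_comm hm.le, pow_right_comm, ← mul_pow] at key
  exact key
end

section
/- Let $h$ be a positive integer, $\alpha$ a real with $1 \le \alpha \le 2$, and $A$, $B$ finite non-empty sets in a commutative group with $|A| = m$ and $|A+B| \le \alpha m$. Then $|A + hB| \le \alpha m + (\alpha - 1)\, m^2 \sum_{j=2}^{h} \left(1 + \tfrac{1}{j}\right) \alpha^{j-1} m^{-1/j}$ (real powers $m^{-1/j}$). -/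
open Pointwise

lemma iterSum_eq_nsmul {G : Type*} [AddCommGroup G] [DecidableEq G] (B : Finset G) (k : ℕ) :
    iterSum B k = k • B := by
  induction k with
  | zero => simp [iterSum, Finset.singleton_zero]
  | succ k ih => rw [iterSum, ih, succ_nsmul]

section RestrictedPetridis

variable {G : Type*} [AddCommGroup G] [DecidableEq G] {X B E : Finset G} {K : ℝ}

/-- Petridis' inequality in an addition graph with some vertices removed. -/
lemma card_add_sdiff_le_of_minimizer (hK : 0 ≤ K)
    (hX : (((X + B) \ E).card : ℝ) = K * X.card)
    (hmin : ∀ Z ⊆ X, K * Z.card ≤ (((Z + B) \ E).card : ℝ)) (C Y : Finset G) :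
    (((X + B + C) \ ((E + C) ∪ (Y + B))).card : ℝ) ≤ K * ((X + C) \ Y).card := by
  induction C using Finset.induction_on with
  | empty => simp
  | insert c C hc ih =>
    set X' := X.filter (fun x => x + c ∈ Y ∪ (X + C)) with hX'
    have hX'X : X' ⊆ X := Finset.filter_subset _ _
    have hsub : (X' + B) \ E ⊆ (X + B) \ E :=
      Finset.sdiff_subset_sdiff (Finset.add_subset_add_right hX'X) subset_rfl
    have hnew : (X + B + insert c C) \ ((E + insert c C) ∪ (Y + B)) ⊆
        ((X + B + C) \ ((E + C) ∪ (Y + B))) ∪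
          (((X + B) \ E) \ ((X' + B) \ E)).image (· + c) := by
      intro z hz
      simp only [Finset.mem_sdiff, Finset.mem_union, not_or] at hz
      obtain ⟨hz1, hz2, hz3⟩ := hz
      have hzE : z ∉ E + C := fun h =>
        hz2 (Finset.add_subset_add_left (Finset.subset_insert _ _) h)
      by_cases hzC : z ∈ X + B + C
      · simp [hzC, hzE, hz3]
      apply Finset.mem_union_right
      obtain ⟨w, hw, c', hc', rfl⟩ := Finset.mem_add.1 hz1
      obtain rfl | hc' := Finset.mem_insert.1 hc'
      · refine Finset.mem_image.2 ⟨w, ?_, rfl⟩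
        refine Finset.mem_sdiff.2 ⟨Finset.mem_sdiff.2 ⟨hw, fun h => hz2 ?_⟩, fun h => ?_⟩
        · exact Finset.add_mem_add h (Finset.mem_insert_self _ _)
        · obtain ⟨x, hx, b, hb, rfl⟩ := Finset.mem_add.1 (Finset.mem_sdiff.1 h).1
          obtain hx | hx := Finset.mem_union.1 (Finset.mem_filter.1 hx).2
          · exact hz3 (by rw [add_right_comm x]; exact Finset.add_mem_add hx hb)
          · exact hzC (by
              rw [add_right_comm x, add_right_comm X]; exact Finset.add_mem_add hx hb)
      · exact absurd (Finset.add_mem_add hw hc') hzC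
    have hold : ((X + C) \ Y) ∪ (X \ X').image (· + c) ⊆ (X + insert c C) \ Y := by
      intro z hz
      obtain hz | hz := Finset.mem_union.1 hz
      · exact Finset.sdiff_subset_sdiff
          (Finset.add_subset_add_left (Finset.subset_insert _ _)) subset_rfl hz
      · obtain ⟨x, hx, rfl⟩ := Finset.mem_image.1 hz
        simp only [hX', Finset.mem_sdiff, Finset.mem_filter, Finset.mem_union, not_and,
          not_or] at hx
        exact Finset.mem_sdiff.2
          ⟨Finset.add_mem_add hx.1 (Finset.mem_insert_self _ _), (hx.2 hx.1).1⟩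
    have hdisj : Disjoint ((X + C) \ Y) ((X \ X').image (· + c)) := by
      rw [Finset.disjoint_right]
      intro z hz hz'
      obtain ⟨x, hx, rfl⟩ := Finset.mem_image.1 hz
      simp only [hX', Finset.mem_sdiff, Finset.mem_filter, Finset.mem_union, not_and,
        not_or] at hx
      exact (hx.2 hx.1).2 (Finset.mem_sdiff.1 hz').1
    have h1 := (Finset.card_le_card hnew).trans (Finset.card_union_le _ _)
    have h2 := Finset.card_le_card hold
    rw [Finset.card_union_of_disjoint hdisj,
      Finset.card_image_of_injective _ (add_left_injective c)] at h2
    rw [Finset.card_image_of_injective _ (add_left_injective c)] at h1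
    have h3 := Finset.card_sdiff_add_card_eq_card hsub
    have h4 := Finset.card_sdiff_add_card_eq_card hX'X
    have h5 := hmin X' hX'X
    rify at h1 h2 h3 h4
    have h6 := mul_le_mul_of_nonneg_left h2 hK
    have h7 : K * X.card = K * (X \ X').card + K * X'.card := by rw [← h4]; ring
    linarith

lemma card_add_nsmul_sdiff_le_of_minimizer (hK : 0 ≤ K)
    (hX : (((X + B) \ E).card : ℝ) = K * X.card)
    (hmin : ∀ Z ⊆ X, K * Z.card ≤ (((Z + B) \ E).card : ℝ)) (n : ℕ) :
    (((X + (n + 1) • B) \ (E + n • B)).card : ℝ) ≤ K ^ (n + 1) * X.card := by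
  induction n with
  | zero => simp [hX]
  | succ n ih =>
    have h := card_add_sdiff_le_of_minimizer hK hX hmin ((n + 1) • B) (E + n • B)
    rw [add_assoc E, ← succ_nsmul, Finset.union_self, add_assoc X, ← succ_nsmul'] at h
    calc _ ≤ _ := h
      _ ≤ K * (K ^ (n + 1) * X.card) := mul_le_mul_of_nonneg_left ih hK
      _ = _ := by ring

lemma card_add_nsmul_sdiff_le {n : ℕ} {L : ℝ} (hL : 0 ≤ L)
    (hB : (((n + 1) • B).card : ℝ) ≤ L ^ (n + 1)) (R E : Finset G) :
    (((R + (n + 1) • B) \ (E + n • B)).card : ℝ) ≤ L ^ n * ((R + B) \ E).card := by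
  induction R using Finset.strongInduction generalizing E with
  | H R ih =>
  obtain rfl | hR := R.eq_empty_or_nonempty
  · simp
  obtain ⟨X, hXR, hXmin⟩ := (R.powerset.erase ∅).exists_min_image
    (fun X => (((X + B) \ E).card : ℝ) / X.card)
    ⟨R, by simp [hR.ne_empty]⟩
  simp only [Finset.mem_erase, Finset.mem_powerset, ne_eq, ← Finset.nonempty_iff_ne_empty]
    at hXR hXmin
  obtain ⟨hX, hXR⟩ := hXR
  set K : ℝ := (((X + B) \ E).card : ℝ) / X.card with hKdef
  have hK : 0 ≤ K := by positivity
  have hXpos : (0 : ℝ) < X.card := by exact_mod_cast hX.card_pos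
  have hXK : (((X + B) \ E).card : ℝ) = K * X.card := by rw [hKdef]; field_simp
  have hmin : ∀ Z ⊆ X, K * Z.card ≤ (((Z + B) \ E).card : ℝ) := by
    intro Z hZ
    obtain rfl | hne := Z.eq_empty_or_nonempty
    · simp
    · exact (le_div_iff₀ (by exact_mod_cast hne.card_pos)).1 (hXmin Z ⟨hne, hZ.trans hXR⟩)
  have hX1 := card_add_nsmul_sdiff_le_of_minimizer hK hXK hmin n
  have hX2 : (((X + (n + 1) • B) \ (E + n • B)).card : ℝ) ≤ L ^ (n + 1) * X.card := by
    have h1 : ((X + (n + 1) • B) \ (E + n • B)).card ≤ X.card * ((n + 1) • B).card :=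
      (Finset.card_le_card Finset.sdiff_subset).trans Finset.card_add_le
    rify at h1
    nlinarith
  have hX3 : (((X + (n + 1) • B) \ (E + n • B)).card : ℝ) ≤ L ^ n * ((X + B) \ E).card := by
    rw [hXK]
    obtain h | h := le_total K L
    · calc _ ≤ _ := hX1
        _ = K ^ n * (K * X.card) := by ring
        _ ≤ _ := mul_le_mul_of_nonneg_right (pow_le_pow_left₀ hK h n) (mul_nonneg hK hXpos.le)
    · calc _ ≤ _ := hX2
        _ = L ^ n * (L * X.card) := by ring
        _ ≤ _ := mul_le_mul_of_nonneg_left (mul_le_mul_of_nonneg_right h hXpos.le)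
            (pow_nonneg hL n)
  have hrest := ih (R \ X) (Finset.sdiff_ssubset hXR hX) (E ∪ (X + B))
  have hRX : R = X ∪ R \ X := (Finset.union_sdiff_of_subset hXR).symm
  have hcover : (R + (n + 1) • B) \ (E + n • B) =
      ((X + (n + 1) • B) \ (E + n • B)) ∪
        ((R \ X + (n + 1) • B) \ ((E ∪ (X + B)) + n • B)) := by
    rw [Finset.union_add, add_assoc X, ← succ_nsmul']
    conv_lhs => rw [hRX, Finset.union_add]
    ext z
    simp only [Finset.mem_union, Finset.mem_sdiff]
    tauto
  have hsplit : (R + B) \ E = ((X + B) \ E) ∪ ((R \ X + B) \ (E ∪ (X + B))) := by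
    conv_lhs => rw [hRX, Finset.union_add]
    ext z
    simp only [Finset.mem_union, Finset.mem_sdiff]
    tauto
  have hdisj : Disjoint ((X + B) \ E) ((R \ X + B) \ (E ∪ (X + B))) := by
    rw [Finset.disjoint_left]
    intro z hz hz'
    simp only [Finset.mem_union, Finset.mem_sdiff] at hz hz'
    tauto
  have hcard := Finset.card_union_le ((X + (n + 1) • B) \ (E + n • B))
    ((R \ X + (n + 1) • B) \ ((E ∪ (X + B)) + n • B))
  rw [← hcover] at hcard
  rw [hsplit, Finset.card_union_of_disjoint hdisj]
  push_cast
  rify at hcard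
  linarith

end RestrictedPetridis

lemma card_add_succ_nsmul_le {G : Type*} [AddCommGroup G] [DecidableEq G]
    {A B : Finset G} {α : ℝ} (hα : 0 ≤ α) (hA : A.Nonempty) (hB : B.Nonempty)
    (hAB : ((A + B).card : ℝ) ≤ α * A.card) (n : ℕ) :
    ((A + (n + 1) • B).card : ℝ) ≤ (A + n • B).card +
      (α - 1) * (A.card : ℝ) ^ 2 * (α ^ n * (A.card : ℝ) ^ (-(1 / ((n + 1 : ℕ) : ℝ)))) := by
  obtain ⟨b, hb⟩ := hB
  have hpos : (0 : ℝ) < A.card := by exact_mod_cast hA.card_pos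
  set t : ℝ := (A.card : ℝ) ^ (1 / ((n + 1 : ℕ) : ℝ)) with ht
  have htpos : 0 < t := by positivity
  have htpow : t ^ (n + 1) = A.card := by
    rw [ht, one_div, Real.rpow_inv_natCast_pow hpos.le n.succ_ne_zero]
  have hnB : (((n + 1) • B).card : ℝ) ≤ (α * t) ^ (n + 1) := by
    have h := Finset.pluennecke_ruzsa_inequality_nsmul_add hA B (n + 1)
    rw [mul_pow, htpow]
    have h' : (((n + 1) • B).card : ℝ) ≤
        (((A + B).card : ℝ) / A.card) ^ (n + 1) * A.card := by
      have h' := (NNRat.cast_le (K := ℝ)).2 h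
      push_cast at h'
      exact h'
    refine h'.trans ?_
    gcongr
    rwa [div_le_iff₀ hpos]
  have hmain := card_add_nsmul_sdiff_le (by positivity) hnB A (A + {b})
  have hsub : A + {b} ⊆ A + B := Finset.add_subset_add_left (by simpa using hb)
  have h1 := Finset.card_sdiff_add_card_eq_card hsub
  have h2 : (A + {b} + n • B).card = (A + n • B).card := by
    rw [add_right_comm, Finset.card_add_singleton]
  have h3 := Finset.card_le_card_sdiff_add_card (s := A + (n + 1) • B) (t := A + {b} + n • B)
  rw [Finset.card_add_singleton] at h1
  rw [h2] at h3
  rify at h1 h3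
  have h4 : (((A + B) \ (A + {b})).card : ℝ) ≤ (α - 1) * A.card := by linarith
  have h5 := mul_le_mul_of_nonneg_left h4 (by positivity : 0 ≤ (α * t) ^ n)
  have h6 : (α - 1) * (A.card : ℝ) ^ 2 * (α ^ n * (A.card : ℝ) ^ (-(1 / ((n + 1 : ℕ) : ℝ)))) =
      (α * t) ^ n * ((α - 1) * A.card) := by
    rw [Real.rpow_neg hpos.le, ← ht, ← htpow]
    field_simp
    ring
  linarith

/-- Ruzsa's bound for `1 ≤ α ≤ 2`:
`|A + hB| ≤ α m + (α - 1) m² ∑_{j=2}^h (1 + 1/j) α^(j-1) m^(-1/j)`. -/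
theorem stmt_1 {G : Type*} [AddCommGroup G] [DecidableEq G]
    (h : ℕ) (hh : 0 < h) (α : ℝ) (hα1 : 1 ≤ α) (hα2 : α ≤ 2)
    (A B : Finset G) (hA : A.Nonempty) (hB : B.Nonempty)
    (m : ℕ) (hm : A.card = m)
    (hAB : ((A + B).card : ℝ) ≤ α * m) :
    ((A + iterSum B h).card : ℝ) ≤
      α * m + (α - 1) * (m : ℝ) ^ 2 *
        ∑ j ∈ Finset.Icc 2 h, (1 + 1 / (j : ℝ)) * α ^ (j - 1) * (m : ℝ) ^ (-(1 / (j : ℝ))) := by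
  subst hm
  rw [iterSum_eq_nsmul]
  induction h, hh using Nat.le_induction with
  | base => simpa using hAB
  | succ n hn ih =>
    have hstep := card_add_succ_nsmul_le (by linarith) hA hB hAB n
    rw [Finset.sum_Icc_succ_top (by omega), mul_add, Nat.add_sub_cancel]
    have hα0 : 0 ≤ α - 1 := by linarith
    have hweight : (α - 1) * (A.card : ℝ) ^ 2 *
          (α ^ n * (A.card : ℝ) ^ (-(1 / ((n + 1 : ℕ) : ℝ)))) ≤
        (α - 1) * (A.card : ℝ) ^ 2 * ((1 + 1 / ((n + 1 : ℕ) : ℝ)) * α ^ n *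
          (A.card : ℝ) ^ (-(1 / ((n + 1 : ℕ) : ℝ)))) := by
      rw [mul_assoc (1 + _)]
      refine mul_le_mul_of_nonneg_left (le_mul_of_one_le_left (by positivity) ?_)
        (by positivity)
      have : (0 : ℝ) ≤ 1 / ((n + 1 : ℕ) : ℝ) := by positivity
      linarith
    linarith
end

section
/- Let $h$ be a positive integer. There exists a constant $C > 0$ depending only on $h$ with the following property: for all finite non-empty sets $A$, $B$ in a commutative group and all reals $\alpha > 0$ with $|A| = m$ and $|A+B| \le \alpha m$, one has $|A + hB| \le \tfrac{e}{h^2} \left(1 - \tfrac{1}{h}\right)^{h-1} \alpha^h\, m^{2-1/h} + C\, \alpha^h\, m^{2 - 2/(h+1)}$ (real powers of $m$, with the convention $0^0 = 1$ when $h = 1$). -/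
open Pointwise

open Finset in
theorem card_insert_add {G : Type*} [AddCommGroup G] [DecidableEq G] (x : G) (Y B : Finset G) :
    #(insert x Y + B) = #(Y + B) + #{b ∈ B | x + b ∉ Y + B} := by
  have h : insert x Y + B = (Y + B) ∪ {b ∈ B | x + b ∉ Y + B}.image (x + ·) := by
    ext y
    simp only [insert_eq, union_add, mem_union, singleton_add, mem_vadd_finset, vadd_eq_add,
      mem_image, mem_filter]
    constructor
    · rintro (⟨b, hb, rfl⟩ | hy)
      · by_cases hxb : x + b ∈ Y + B
        exacts [Or.inl hxb, Or.inr ⟨b, ⟨hb, hxb⟩, rfl⟩]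
      · exact Or.inl hy
    · rintro (hy | ⟨b, ⟨hb, -⟩, rfl⟩)
      exacts [Or.inr hy, Or.inl ⟨b, hb, rfl⟩]
  rw [h, card_union_of_disjoint, card_image_of_injective _ (add_right_injective x)]
  rw [disjoint_right]
  intro y hy
  obtain ⟨b, hb, rfl⟩ := mem_image.1 hy
  exact (mem_filter.1 hb).2

open Finset in
/-- If `X` minimises `|Z + B| - t |Z|` over its own subsets `Z`, then translates of `X` grow by a
factor of at most `t` when `B` is added. -/
theorem card_add_add_le_of_minimal {G : Type*} [AddCommGroup G] [DecidableEq G]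
    {X B : Finset G} {t : ℝ}
    (hX : ∀ Z ⊆ X, (#(X + B) : ℝ) - t * #X ≤ #(Z + B) - t * #Z) (D : Finset G) :
    (#(D + X + B) : ℝ) ≤ t * #(D + X) := by
  induction D using Finset.induction_on with
  | empty => simp
  | insert d D _ ih =>
    set Z := X.filter (fun x => d + x ∈ D + X) with hZ
    have hZX : Z ⊆ X := filter_subset _ _
    have c₁ : (#(insert d D + X) : ℝ) = #(D + X) + (#X - #Z) := by
      rw [card_insert_add, filter_not, ← hZ, ← cast_card_sdiff hZX]
      push_cast
      rfl
    have hsub : {s ∈ X + B | d + s ∉ D + (X + B)} ⊆ (X + B) \ (Z + B) := by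
      intro s hs
      obtain ⟨hs, hds⟩ := mem_filter.1 hs
      refine mem_sdiff.2 ⟨hs, fun hsZ => hds ?_⟩
      obtain ⟨z, hz, b, hb, rfl⟩ := mem_add.1 hsZ
      rw [← add_assoc, ← add_assoc]
      exact add_mem_add (mem_filter.1 hz).2 hb
    have c₂ : (#(insert d D + X + B) : ℝ) ≤ #(D + X + B) + (#(X + B) - #(Z + B)) := by
      rw [← cast_card_sdiff (add_subset_add_right hZX), add_assoc, add_assoc, card_insert_add]
      exact_mod_cast Nat.add_le_add_left (card_le_card hsub) _
    have := hX Z hZX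
    rw [c₁]
    linarith

open Finset in
theorem card_add_iterSum_le_of_minimal {G : Type*} [AddCommGroup G] [DecidableEq G]
    {X B : Finset G} {t : ℝ} (ht : 0 ≤ t)
    (hX : ∀ Z ⊆ X, (#(X + B) : ℝ) - t * #X ≤ #(Z + B) - t * #Z) (k : ℕ) :
    (#(X + iterSum B k) : ℝ) ≤ t ^ k * #X := by
  induction k with
  | zero => simp [iterSum]
  | succ k ih =>
    have := card_add_add_le_of_minimal hX (iterSum B k)
    rw [iterSum, ← add_assoc, add_comm X]
    rw [add_comm X] at ih
    calc _ ≤ _ := this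
      _ ≤ t * (t ^ k * #X) := by gcongr
      _ = _ := by ring

open Finset in
theorem card_iterSum_le_multichoose {G : Type*} [AddCommGroup G] [DecidableEq G]
    (B : Finset G) (k : ℕ) : #(iterSum B k) ≤ (#B).multichoose k := by
  have h : iterSum B k ⊆
      (univ : Finset (Sym B k)).image fun s : Sym B k => ((s : Multiset B).map Subtype.val).sum := by
    induction k with
    | zero =>
      intro y hy
      exact mem_image.2 ⟨Sym.nil, mem_univ _, by simpa [iterSum, eq_comm] using hy⟩
    | succ k ih =>
      intro y hy
      obtain ⟨u, hu, b, hb, rfl⟩ := mem_add.1 hy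
      obtain ⟨s, -, rfl⟩ := mem_image.1 (ih hu)
      exact mem_image.2 ⟨⟨b, hb⟩ ::ₛ s, mem_univ _, by simp [Sym.coe_cons, add_comm]⟩
  refine ((card_le_card h).trans card_image_le).trans_eq ?_
  rw [card_univ, Sym.card_sym_eq_multichoose, Fintype.card_coe]

open Finset Nat in
theorem card_iterSum_mul_factorial_le {G : Type*} [AddCommGroup G] [DecidableEq G]
    (B : Finset G) (k : ℕ) :
    #(iterSum B k) * k ! ≤ (#B + k) ^ k := by
  calc #(iterSum B k) * k ! ≤ (#B).multichoose k * k ! := by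
        gcongr
        exact card_iterSum_le_multichoose B k
    _ = (#B + k - 1).descFactorial k := by
      rw [Nat.multichoose_eq, mul_comm, Nat.descFactorial_eq_factorial_mul_choose]
    _ ≤ (#B + k - 1) ^ k := Nat.descFactorial_le_pow _ _
    _ ≤ (#B + k) ^ k := by gcongr; exact Nat.sub_le _ _

open Finset in
/-- The bound `k! ≥ (k / e) ^ k` turns the multiset count of `kB` into a pure power. -/
theorem card_iterSum_le_pow {G : Type*} [AddCommGroup G] [DecidableEq G]
    (B : Finset G) (k : ℕ) (hk : 0 < k) :
    (#(iterSum B k) : ℝ) ≤ (Real.exp 1 / k * (#B + k)) ^ k := by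
  have h₁ : (#(iterSum B k) : ℝ) * (k.factorial : ℝ) ≤ (#B + k : ℝ) ^ k := by
    exact_mod_cast card_iterSum_mul_factorial_le B k
  have h₂ := Real.pow_div_factorial_le_exp (x := k) (Nat.cast_nonneg k) k
  have hf : (0 : ℝ) < k.factorial := by positivity
  have hk' : (0 : ℝ) < k := by positivity
  rw [div_le_iff₀ hf, ← mul_one (k : ℝ), Real.exp_nat_mul, mul_one] at h₂
  rw [mul_pow, div_pow, div_mul_eq_mul_div, le_div_iff₀ (by positivity)]
  calc (#(iterSum B k) : ℝ) * (k : ℝ) ^ k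
      ≤ #(iterSum B k) * (Real.exp 1 ^ k * k.factorial) := by gcongr
    _ = Real.exp 1 ^ k * (#(iterSum B k) * k.factorial) := by ring
    _ ≤ _ := by gcongr

theorem le_pow_mul_of_le_pow_succ {x p q : ℝ} (n : ℕ) (hp : 0 ≤ p) (hq : 0 ≤ q)
    (hxp : x ≤ p ^ (n + 1)) (hxq : x ≤ q ^ (n + 1)) : x ≤ p ^ n * q := by
  obtain hpq | hpq := le_total p q
  · exact hxp.trans (by rw [pow_succ]; gcongr)
  · exact hxq.trans (by rw [pow_succ]; gcongr)

open Finset in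
theorem mem_add_iterSum_of_notMem {G : Type*} [AddCommGroup G] [DecidableEq G]
    {Y B : Finset G} {x : G} {k : ℕ} {s : G} (hs : s ∈ iterSum B k)
    (hxs : x + s ∉ Y + iterSum B k) :
    s ∈ iterSum (B.filter fun b => x + b ∉ Y + B) k := by
  induction k generalizing s with
  | zero => exact hs
  | succ k ih =>
    obtain ⟨u, hu, b, hb, rfl⟩ := mem_add.1 hs
    refine add_mem_add (ih hu fun hxu => hxs ?_) (mem_filter.2 ⟨hb, fun hxb => hxs ?_⟩)
    · obtain ⟨y, hy, v, hv, hyv⟩ := mem_add.1 hxu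
      rw [← add_assoc, ← hyv, add_assoc]
      exact add_mem_add hy (add_mem_add hv hb)
    · obtain ⟨y, hy, v, hv, hyv⟩ := mem_add.1 hxb
      rw [add_left_comm, ← hyv, ← add_assoc, add_comm u, add_assoc]
      exact add_mem_add hy (add_mem_add hu hv)

open Finset in
/-- Growth of `Y + (n+1)B` when a single element is added to `Y`. -/
theorem card_insert_add_iterSum_le {G : Type*} [AddCommGroup G] [DecidableEq G]
    {B : Finset G} {n : ℕ} {p : ℝ} (hp : 0 ≤ p) (hB : (#(iterSum B (n + 1)) : ℝ) ≤ p ^ (n + 1))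
    (x : G) (Y : Finset G) :
    (#(insert x Y + iterSum B (n + 1)) : ℝ) ≤ #(Y + iterSum B (n + 1)) +
      p ^ n * (Real.exp 1 / (n + 1) * (#(insert x Y + B) - #(Y + B) + (n + 1))) := by
  set B' := B.filter fun b => x + b ∉ Y + B with hB'
  set N := (iterSum B (n + 1)).filter fun s => x + s ∉ Y + iterSum B (n + 1) with hN
  have c₃ : (#N : ℝ) ≤ p ^ (n + 1) :=
    le_trans (by exact_mod_cast card_le_card (filter_subset _ _)) hB
  have c₄ : (#N : ℝ) ≤ (Real.exp 1 / (n + 1) * (#B' + (n + 1))) ^ (n + 1) := by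
    have hNB' : N ⊆ iterSum B' (n + 1) := fun s hs =>
      mem_add_iterSum_of_notMem (mem_filter.1 hs).1 (mem_filter.1 hs).2
    have := card_iterSum_le_pow B' (n + 1) n.succ_pos
    push_cast at this
    exact le_trans (by exact_mod_cast card_le_card hNB') this
  have := le_pow_mul_of_le_pow_succ n hp (by positivity) c₃ c₄
  rw [card_insert_add, card_insert_add, ← hB', ← hN]
  push_cast
  rw [add_sub_cancel_left]
  linarith

open Finset in
theorem card_union_add_iterSum_le {G : Type*} [AddCommGroup G] [DecidableEq G]
    {B : Finset G} {n : ℕ} {p : ℝ} (hp : 0 ≤ p) (hB : (#(iterSum B (n + 1)) : ℝ) ≤ p ^ (n + 1))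
    (S X : Finset G) :
    (#(S ∪ X + iterSum B (n + 1)) : ℝ) ≤ #(X + iterSum B (n + 1)) +
      p ^ n * (Real.exp 1 / (n + 1) * (#(S ∪ X + B) - #(X + B) + (n + 1) * #S)) := by
  induction S using Finset.induction_on with
  | empty => simp
  | insert x S hx ih =>
    have := card_insert_add_iterSum_le hp hB x (S ∪ X)
    rw [insert_union, card_insert_of_notMem hx]
    push_cast
    linarith

theorem succ_mul_pow_le_mul_pow_succ_add_one {t : ℝ} (ht : 0 ≤ t) (n : ℕ) :
    (n + 1) * t ^ n ≤ n * t ^ (n + 1) + 1 := by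
  induction n with
  | zero => simp
  | succ n ih =>
    have h₁ : 0 ≤ (t - 1) * (t ^ (n + 1) - 1) := by
      obtain h | h := le_total 1 t
      · exact mul_nonneg (by linarith) (by linarith [one_le_pow₀ h (n := n + 1)])
      · exact mul_nonneg_of_nonpos_of_nonpos (by linarith)
          (by linarith [pow_le_one₀ ht h (n := n + 1)])
    have h₂ := mul_le_mul_of_nonneg_left ih ht
    push_cast
    rw [pow_succ t (n + 1)]
    rw [pow_succ] at h₁ h₂ ⊢
    linarith

theorem pow_mul_sub_le {a x : ℝ} (ha : 0 < a) (hx : 0 ≤ x) (n : ℕ) :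
    x ^ n * (a - x) ≤ a ^ (n + 1) * (1 / (n + 1) * (1 - 1 / (n + 1)) ^ n) := by
  obtain rfl | hn := n.eq_zero_or_pos
  · simpa using hx
  have hn' : (0 : ℝ) < n := by exact_mod_cast hn
  have hc : (1 : ℝ) - 1 / (n + 1) = n / (n + 1) := by field_simp; ring
  rw [hc]
  set c : ℝ := n / (n + 1) with hc'
  have hc₀ : 0 < c := by positivity
  have h := succ_mul_pow_le_mul_pow_succ_add_one (t := x / (a * c)) (by positivity) n
  set t := x / (a * c) with ht
  have hxt : x = a * c * t := by rw [ht]; field_simp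
  have hcn : c * (n + 1) = n := by rw [hc']; field_simp
  have key : t ^ n * (1 - c * t) ≤ 1 / (n + 1) := by
    rw [le_div_iff₀ (by positivity)]
    calc t ^ n * (1 - c * t) * (n + 1) = (n + 1) * t ^ n - (c * (n + 1)) * t ^ (n + 1) := by ring
      _ ≤ 1 := by rw [hcn]; linarith
  calc x ^ n * (a - x) = a ^ (n + 1) * c ^ n * (t ^ n * (1 - c * t)) := by rw [hxt]; ring
    _ ≤ a ^ (n + 1) * c ^ n * (1 / (n + 1)) := by gcongr
    _ = _ := by ring

open Finset in
/-- The bound with a free parameter `ε`, which controls the size of the exceptional part of `A`. -/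
theorem card_add_iterSum_le_of_parameter {G : Type*} [AddCommGroup G] [DecidableEq G]
    {A B : Finset G} (hA : A.Nonempty) (hB : B.Nonempty) {a M ε : ℝ} (ha : 0 < a)
    (hAB : (#(A + B) : ℝ) ≤ a * #A) (n : ℕ) (hM : 0 ≤ M) (hMA : M ^ (n + 1) = #A)
    (hε : 0 < ε) :
    (#(A + iterSum B (n + 1)) : ℝ) ≤ (a / ε) ^ (n + 1) * #A +
      M ^ n * (Real.exp 1 / (n + 1) * #A *
        (a ^ (n + 1) * (1 / (n + 1) * (1 - 1 / (n + 1)) ^ n) + a ^ (n + 1) * (n + 2) * ε)) := by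
  have hA₀ : (0 : ℝ) < #A := by exact_mod_cast hA.card_pos
  have ha₁ : 1 ≤ a := by
    have : (#A : ℝ) ≤ #(A + B) := by exact_mod_cast card_le_card_add_right hB
    by_contra! h
    nlinarith
  obtain ⟨X₀, hX₀, hX₀min⟩ := exists_min_image (A.powerset.erase ∅)
    (fun Z => (#(Z + B) : ℝ) / #Z) ⟨A, by simp [hA.ne_empty]⟩
  rw [mem_erase, mem_powerset, ← nonempty_iff_ne_empty] at hX₀
  obtain ⟨hX₀ne, hX₀A⟩ := hX₀
  set K : ℝ := #(X₀ + B) / #X₀ with hK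
  have hK₀ : 0 ≤ K := by positivity
  have hKmin : ∀ Z ⊆ A, K * #Z ≤ #(Z + B) := by
    intro Z hZ
    obtain rfl | hZne := Z.eq_empty_or_nonempty
    · simp
    · rw [← le_div_iff₀ (by exact_mod_cast hZne.card_pos)]
      exact hX₀min Z (by simp [hZne.ne_empty, hZ])
  have hKa : K ≤ a := le_of_mul_le_mul_right ((hKmin A Subset.rfl).trans hAB) hA₀
  have hX₀K : (#(X₀ + B) : ℝ) = K * #X₀ := by
    have : (0 : ℝ) < #X₀ := by exact_mod_cast hX₀ne.card_pos
    rw [hK]; field_simp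
  clear_value K
  clear hX₀min hK
  have hp : (#(iterSum B (n + 1)) : ℝ) ≤ (K * M) ^ (n + 1) := by
    calc (#(iterSum B (n + 1)) : ℝ) ≤ #(X₀ + iterSum B (n + 1)) := by
          exact_mod_cast card_le_card_add_left hX₀ne
      _ ≤ K ^ (n + 1) * #X₀ := by
          refine card_add_iterSum_le_of_minimal hK₀ (fun Z hZ => ?_) _
          linarith [hKmin Z (hZ.trans hX₀A)]
      _ ≤ K ^ (n + 1) * #A := by gcongr
      _ = _ := by rw [mul_pow, hMA]
  obtain ⟨X, hXA, hXmin⟩ := exists_min_image A.powerset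
    (fun Z => (#(Z + B) : ℝ) - a / ε * #Z) ⟨A, by simp⟩
  rw [mem_powerset] at hXA
  have hX := card_add_iterSum_le_of_minimal (B := B) (t := a / ε) (by positivity)
    (fun Z hZ => hXmin Z (mem_powerset.2 (hZ.trans hXA))) (n + 1)
  have hd : (#(A \ X) : ℝ) = #A - #X := cast_card_sdiff hXA
  have hdε : (#(A \ X) : ℝ) ≤ ε * #A := by
    have h₁ := hXmin A (mem_powerset_self A)
    have h₂ : a / ε * #(A \ X) ≤ a * #A := by
      rw [hd]
      have : (0 : ℝ) ≤ #(X + B) := by positivity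
      linarith
    rw [div_mul_eq_mul_div, div_le_iff₀ hε, mul_assoc] at h₂
    linarith [le_of_mul_le_mul_left h₂ ha]
  have hmain := card_union_add_iterSum_le (by positivity) hp (A \ X) X
  rw [sdiff_union_of_subset hXA] at hmain
  have hXle : (#X : ℝ) ≤ #A := by exact_mod_cast card_le_card hXA
  have hinner : (#(A + B) : ℝ) - #(X + B) + (n + 1) * #(A \ X)
      ≤ #A * ((a - K) + a * (n + 2) * ε) := by
    have h₁ := hKmin X hXA
    have h₂ : K * #(A \ X) ≤ a * (ε * #A) := by gcongr
    have h₃ : (n + 1) * (#(A \ X) : ℝ) ≤ (n + 1) * (a * (ε * #A)) := by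
      gcongr
      nlinarith [mul_pos hε hA₀]
    rw [hd] at h₂
    nlinarith
  have hpow : K ^ n * ((a - K) + a * (n + 2) * ε) ≤
      a ^ (n + 1) * (1 / (n + 1) * (1 - 1 / (n + 1)) ^ n) + a ^ (n + 1) * (n + 2) * ε := by
    have h₁ := pow_mul_sub_le ha hK₀ n
    have h₂ : K ^ n * (a * (n + 2) * ε) ≤ a ^ n * (a * (n + 2) * ε) := by gcongr
    rw [mul_add]
    refine add_le_add h₁ (h₂.trans_eq (by ring))
  calc (#(A + iterSum B (n + 1)) : ℝ) ≤ _ := hmain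
    _ ≤ (a / ε) ^ (n + 1) * #A + (K * M) ^ n *
        (Real.exp 1 / (n + 1) * (#A * ((a - K) + a * (n + 2) * ε))) := by
      gcongr
      exact hX.trans (by gcongr)
    _ = (a / ε) ^ (n + 1) * #A + M ^ n * (Real.exp 1 / (n + 1) * #A *
        (K ^ n * ((a - K) + a * (n + 2) * ε))) := by rw [mul_pow]; ring
    _ ≤ _ := by gcongr

/-- There is `C > 0` depending only on `h` such that whenever `|A| = m` and `|A + B| ≤ α m`,
one has `|A + hB| ≤ (e/h²) (1 - 1/h)^(h-1) α^h m^(2-1/h) + C α^h m^(2-2/(h+1))`. -/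
theorem stmt_3 (h : ℕ) (hh : 0 < h) :
    ∃ C : ℝ, 0 < C ∧
      ∀ (G : Type) (_ : AddCommGroup G) (_ : DecidableEq G)
        (A B : Finset G) (_ : A.Nonempty) (_ : B.Nonempty)
        (α : ℝ) (_ : 0 < α) (m : ℕ) (_ : A.card = m)
        (_ : ((A + B).card : ℝ) ≤ α * m),
        ((A + iterSum B h).card : ℝ) ≤
          (Real.exp 1 / (h : ℝ) ^ 2) * (1 - 1 / (h : ℝ)) ^ (h - 1) * α ^ h *
              (m : ℝ) ^ (2 - 1 / (h : ℝ))
            + C * α ^ h * (m : ℝ) ^ (2 - 2 / ((h : ℝ) + 1)) := by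
  obtain ⟨n, rfl⟩ : ∃ n, h = n + 1 := ⟨h - 1, by omega⟩
  refine ⟨1 + Real.exp 1 / (n + 1) * (n + 2), by positivity, ?_⟩
  intro G _ _ A B hA hB a ha m hm hAB
  subst hm
  have hx : (0 : ℝ) < A.card := by exact_mod_cast hA.card_pos
  set x : ℝ := (A.card : ℝ) with hxdef
  have hM : (x ^ (1 / ((n : ℝ) + 1))) ^ (n + 1) = x := by
    rw [← Real.rpow_mul_natCast hx.le]
    push_cast
    rw [one_div_mul_cancel (by positivity), Real.rpow_one]
  have key := card_add_iterSum_le_of_parameter hA hB ha hAB n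
    (Real.rpow_nonneg hx.le (1 / ((n : ℝ) + 1))) hM
    (Real.rpow_pos_of_pos hx (-(n / (((n : ℝ) + 1) * (n + 2)))))
  rw [← hxdef] at key
  have e₁ : (x ^ (1 / ((n : ℝ) + 1))) ^ n * x = x ^ (2 - 1 / ((n : ℝ) + 1)) := by
    rw [← Real.rpow_mul_natCast hx.le, ← Real.rpow_add_one hx.ne']
    congr 1
    field_simp
    ring
  have e₂ : x ^ (2 - 1 / ((n : ℝ) + 1)) * x ^ (-((n : ℝ) / ((n + 1) * (n + 2)))) =
      x ^ (2 - 2 / ((n : ℝ) + 1 + 1)) := by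
    rw [← Real.rpow_add hx]
    congr 1
    field_simp
    ring
  have e₃ : (a / x ^ (-((n : ℝ) / ((n + 1) * (n + 2))))) ^ (n + 1) * x =
      a ^ (n + 1) * x ^ (2 - 2 / ((n : ℝ) + 1 + 1)) := by
    rw [Real.rpow_neg hx.le, div_inv_eq_mul, mul_pow, mul_assoc, ← Real.rpow_mul_natCast hx.le,
      ← Real.rpow_add_one hx.ne']
    congr 2
    push_cast
    field_simp
    ring
  rw [e₃] at key
  push_cast
  refine key.trans_eq ?_
  rw [← e₂, ← e₁]
  field_simp
  ring
end

section
/- Let $h$ be a positive integer, $\alpha$ a positive real, and $A$, $B$ finite non-empty sets in a commutative group with $|A| = m$ and $|A+B| \le \alpha m$. For each $2 \le i \le h$ let $\beta_i$ be the unique positive real satisfying $\prod_{r=0}^{i-1} (\beta_i + r) = i! \cdot |iB|$ (i.e. $\binom{\beta_i + i - 1}{i} = |iB|$ as a generalized binomial coefficient). Then $|A + hB| \le \alpha m + (\alpha - 1)\, m \sum_{i=2}^{h} \frac{|iB|}{\beta_i}$. -/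
open Pointwise

section IterSum

variable {G : Type*} [AddCommGroup G] [DecidableEq G]

theorem iterSum_mono {B C : Finset G} (hBC : B ⊆ C) (k : ℕ) : iterSum B k ⊆ iterSum C k := by
  induction k with
  | zero => exact subset_rfl
  | succ k ih => exact Finset.add_subset_add ih hBC

/-- An element of `(k+1)B` either is a sum of elements of `C` only, or one of its summands
can be chosen outside `C`. -/
theorem mem_iterSum_or_exists_notMem {B : Finset G} (C : Finset G) {k : ℕ} {s : G}
    (hs : s ∈ iterSum B (k + 1)) :
    s ∈ iterSum C (k + 1) ∨ ∃ b ∈ B, b ∉ C ∧ ∃ t ∈ iterSum B k, s = b + t := by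
  induction k generalizing s with
  | zero =>
    obtain ⟨t, ht, b, hb, rfl⟩ := Finset.mem_add.1 hs
    by_cases hbC : b ∈ C
    · exact Or.inl (Finset.add_mem_add ht hbC)
    · exact Or.inr ⟨b, hb, hbC, t, ht, add_comm t b⟩
  | succ k ih =>
    obtain ⟨t, ht, b, hb, rfl⟩ := Finset.mem_add.1 hs
    by_cases hbC : b ∈ C
    · rcases ih ht with h | ⟨c, hc, hcC, u, hu, rfl⟩
      · exact Or.inl (Finset.add_mem_add h hbC)
      · exact Or.inr ⟨c, hc, hcC, u + b, Finset.add_mem_add hu hb, add_assoc c u b⟩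
    · exact Or.inr ⟨b, hb, hbC, t, ht, add_comm t b⟩

theorem iterSum_subset_image_sym (B : Finset G) (k : ℕ) :
    iterSum B k ⊆
      (Finset.univ : Finset (Sym B k)).image fun s : Sym B k => ((s : Multiset B).map Subtype.val).sum := by
  induction k with
  | zero =>
    intro s hs
    exact Finset.mem_image.2 ⟨Sym.nil, Finset.mem_univ _, (Finset.mem_singleton.1 hs).symm⟩
  | succ k ih =>
    intro s hs
    obtain ⟨t, ht, b, hb, rfl⟩ := Finset.mem_add.1 hs
    obtain ⟨u, -, rfl⟩ := Finset.mem_image.1 (ih ht)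
    exact Finset.mem_image.2 ⟨Sym.cons ⟨b, hb⟩ u, Finset.mem_univ _, by
      rw [Sym.coe_cons, Multiset.map_cons, Multiset.sum_cons, add_comm]⟩

theorem factorial_mul_card_iterSum_le (B : Finset G) (k : ℕ) :
    k.factorial * (iterSum B k).card ≤ ∏ r ∈ Finset.range k, (B.card + r) := by
  have hcard : (iterSum B k).card ≤ B.card.multichoose k := by
    have h := (Finset.card_le_card (iterSum_subset_image_sym B k)).trans Finset.card_image_le
    rwa [Finset.card_univ, Sym.card_sym_eq_multichoose, Fintype.card_coe] at h
  rw [← Nat.ascFactorial_eq_prod_range, Nat.ascFactorial_eq_factorial_mul_choose',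
    ← Nat.multichoose_eq]
  exact Nat.mul_le_mul_left _ hcard

/-- If `β` is the pseudo-cardinality of `B` at level `k`, then `|kC| / |C| ≤ |kB| / β` for
every `C ⊆ B`. -/
theorem card_iterSum_le_of_subset {B C : Finset G} (hCB : C ⊆ B) {k : ℕ} (hk : 0 < k) {β : ℝ}
    (hβ : 0 < β)
    (hprod : ∏ r ∈ Finset.range k, (β + r) = (k.factorial : ℝ) * (iterSum B k).card) :
    ((iterSum C k).card : ℝ) ≤ C.card * ((iterSum B k).card / β) := by
  rw [← mul_div_assoc, le_div_iff₀ hβ]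
  rcases le_total β C.card with hle | hle
  · have hmono : ((iterSum C k).card : ℝ) ≤ (iterSum B k).card :=
      mod_cast Finset.card_le_card (iterSum_mono hCB k)
    rw [mul_comm (C.card : ℝ)]
    gcongr
  · obtain ⟨k, rfl⟩ := Nat.exists_eq_add_of_lt hk
    simp only [zero_add] at *
    have hfac : (0 : ℝ) < (k + 1).factorial := by positivity
    have hC : ((k + 1).factorial : ℝ) * (iterSum C (k + 1)).card
        ≤ ∏ r ∈ Finset.range (k + 1), ((C.card : ℝ) + r) :=
      mod_cast factorial_mul_card_iterSum_le C (k + 1)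
    rw [Finset.prod_range_succ'] at hprod hC
    simp only [Nat.cast_zero, add_zero] at hprod hC
    have hQ : ∏ r ∈ Finset.range k, ((C.card : ℝ) + (r + 1 : ℕ))
        ≤ ∏ r ∈ Finset.range k, (β + (r + 1 : ℕ)) :=
      Finset.prod_le_prod (fun _ _ => by positivity) fun _ _ => by gcongr
    refine le_of_mul_le_mul_left ?_ hfac
    calc ((k + 1).factorial : ℝ) * ((iterSum C (k + 1)).card * β)
        = (k + 1).factorial * (iterSum C (k + 1)).card * β := by ring
      _ ≤ (∏ r ∈ Finset.range k, ((C.card : ℝ) + (r + 1 : ℕ))) * C.card * β := by gcongr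
      _ ≤ (∏ r ∈ Finset.range k, (β + (r + 1 : ℕ))) * C.card * β := by gcongr
      _ = C.card * ((∏ r ∈ Finset.range k, (β + (r + 1 : ℕ))) * β) := by ring
      _ = (k + 1).factorial * (C.card * (iterSum B (k + 1)).card) := by rw [hprod]; ring

/-- If `|(k+1)C| ≤ K |C|` for all `C ⊆ B`, then the number of elements of `A + (k+1)B` outside
`D + kB` is at most `K` times the number of elements of `A + B` outside `D`. -/
theorem card_add_iterSum_sdiff_le {B : Finset G} {k : ℕ} {K : ℝ} (hK0 : 0 ≤ K)
    (hK : ∀ C ⊆ B, ((iterSum C (k + 1)).card : ℝ) ≤ C.card * K) (A D : Finset G) :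
    (((A + iterSum B (k + 1)) \ (D + iterSum B k)).card : ℝ) ≤ ((A + B) \ D).card * K := by
  induction A using Finset.induction_on with
  | empty => simp
  | insert a A _ ih =>
    set C := B.filter fun b => a + b ∉ D ∪ (A + B)
    have hsub : (insert a A + iterSum B (k + 1)) \ (D + iterSum B k) ⊆
        ((A + iterSum B (k + 1)) \ (D + iterSum B k)) ∪
          (iterSum C (k + 1)).image (a + ·) := by
      intro z hz
      obtain ⟨hz, hzD⟩ := Finset.mem_sdiff.1 hz
      by_cases hzA : z ∈ A + iterSum B (k + 1)
      · exact Finset.mem_union_left _ (Finset.mem_sdiff.2 ⟨hzA, hzD⟩)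
      refine Finset.mem_union_right _ ?_
      obtain ⟨a', ha', s, hs, rfl⟩ := Finset.mem_add.1 hz
      rcases Finset.mem_insert.1 ha' with rfl | ha'
      swap
      · exact absurd (Finset.add_mem_add ha' hs) hzA
      rcases mem_iterSum_or_exists_notMem C hs with h | ⟨b, hb, hbC, t, ht, rfl⟩
      · exact Finset.mem_image_of_mem _ h
      have hmem : a' + b ∈ D ∪ (A + B) := by
        by_contra hcon
        exact hbC (Finset.mem_filter.2 ⟨hb, hcon⟩)
      rw [← add_assoc] at hzD hzA
      rcases Finset.mem_union.1 hmem with h | h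
      · exact absurd (Finset.add_mem_add h ht) hzD
      · obtain ⟨x, hx, y, hy, hxy⟩ := Finset.mem_add.1 h
        refine absurd ?_ hzA
        rw [← hxy, add_assoc, add_comm y]
        exact Finset.add_mem_add hx (Finset.add_mem_add ht hy)
    have hdisj : Disjoint ((A + B) \ D) (C.image (a + ·)) := by
      rw [Finset.disjoint_right]
      intro z hz hz'
      obtain ⟨b, hb, rfl⟩ := Finset.mem_image.1 hz
      exact (Finset.mem_filter.1 hb).2
        (Finset.mem_union_right _ (Finset.mem_sdiff.1 hz').1)
    have hsup : ((A + B) \ D) ∪ C.image (a + ·) ⊆ (insert a A + B) \ D := by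
      intro z hz
      rcases Finset.mem_union.1 hz with hz | hz
      · exact Finset.sdiff_subset_sdiff
          (Finset.add_subset_add_right (Finset.subset_insert a A)) subset_rfl hz
      · obtain ⟨b, hb, rfl⟩ := Finset.mem_image.1 hz
        obtain ⟨hbB, hb⟩ := Finset.mem_filter.1 hb
        exact Finset.mem_sdiff.2 ⟨Finset.add_mem_add (Finset.mem_insert_self a A) hbB,
          fun h => hb (Finset.mem_union_left _ h)⟩
    have hlow : ((A + B) \ D).card + C.card ≤ ((insert a A + B) \ D).card := by
      have := Finset.card_le_card hsup
      rwa [Finset.card_union_of_disjoint hdisj,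
        Finset.card_image_of_injective _ (add_right_injective a)] at this
    have hupp : ((insert a A + iterSum B (k + 1)) \ (D + iterSum B k)).card ≤
        ((A + iterSum B (k + 1)) \ (D + iterSum B k)).card + (iterSum C (k + 1)).card :=
      (Finset.card_le_card hsub).trans ((Finset.card_union_le _ _).trans
        (Nat.add_le_add_left Finset.card_image_le _))
    calc (((insert a A + iterSum B (k + 1)) \ (D + iterSum B k)).card : ℝ)
          ≤ ((A + iterSum B (k + 1)) \ (D + iterSum B k)).card +
              (iterSum C (k + 1)).card := mod_cast hupp
        _ ≤ ((A + B) \ D).card * K + C.card * K :=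
            add_le_add ih (hK C (Finset.filter_subset _ _))
        _ = (((A + B) \ D).card + C.card : ℕ) * K := by push_cast; ring
        _ ≤ ((insert a A + B) \ D).card * K := by gcongr

theorem card_add_iterSum_succ_le {A B : Finset G} (hB : B.Nonempty) {k : ℕ} {K : ℝ} (hK0 : 0 ≤ K)
    (hK : ∀ C ⊆ B, ((iterSum C (k + 1)).card : ℝ) ≤ C.card * K) :
    ((A + iterSum B (k + 1)).card : ℝ) ≤
      (A + iterSum B k).card + ((A + B).card - A.card) * K := by
  obtain ⟨b, hb⟩ := hB
  have hexp := card_add_iterSum_sdiff_le hK0 hK A (A + {b})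
  have hsub : A + {b} ⊆ A + B :=
    Finset.add_subset_add_left (Finset.singleton_subset_iff.2 hb)
  rw [Finset.cast_card_sdiff hsub, Finset.card_add_singleton] at hexp
  have htrans : (A + {b} + iterSum B k).card = (A + iterSum B k).card := by
    rw [add_right_comm, Finset.card_add_singleton]
  have hsplit := Finset.card_le_card_sdiff_add_card
    (s := A + iterSum B (k + 1)) (t := A + {b} + iterSum B k)
  rw [htrans] at hsplit
  have hsplit' : ((A + iterSum B (k + 1)).card : ℝ) ≤
      ((A + iterSum B (k + 1)) \ (A + {b} + iterSum B k)).card + (A + iterSum B k).card :=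
    mod_cast hsplit
  linarith

end IterSum

/-- If `|A| = m`, `|A+B| ≤ α m` and for `2 ≤ i ≤ h` the pseudo-cardinality `β i` of `B`
satisfies `∏_{r=0}^{i-1} (β i + r) = i! |iB|`, then
`|A + hB| ≤ α m + (α - 1) m ∑_{i=2}^h |iB| / β i`. -/
theorem stmt_5 {G : Type*} [AddCommGroup G] [DecidableEq G]
    (h : ℕ) (hh : 0 < h) (α : ℝ) (hα : 0 < α)
    (A B : Finset G) (hA : A.Nonempty) (hB : B.Nonempty)
    (m : ℕ) (hm : A.card = m)
    (hAB : ((A + B).card : ℝ) ≤ α * m)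
    (β : ℕ → ℝ) (hβpos : ∀ i ∈ Finset.Icc 2 h, 0 < β i)
    (hβ : ∀ i ∈ Finset.Icc 2 h,
      ∏ r ∈ Finset.range i, (β i + r) = (Nat.factorial i : ℝ) * ((iterSum B i).card : ℝ)) :
    ((A + iterSum B h).card : ℝ) ≤
      α * m + (α - 1) * m * ∑ i ∈ Finset.Icc 2 h, ((iterSum B i).card : ℝ) / β i := by
  subst hm
  induction h, hh using Nat.le_induction with
  | base => simpa [show iterSum B 1 = B from zero_add B] using hAB
  | succ k hk ih =>
    have hk2 : k + 1 ∈ Finset.Icc 2 (k + 1) := Finset.mem_Icc.2 ⟨by omega, le_rfl⟩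
    have hIcc : Finset.Icc 2 k ⊆ Finset.Icc 2 (k + 1) :=
      Finset.Icc_subset_Icc_right k.le_succ
    have ih := ih (fun i hi => hβpos i (hIcc hi)) (fun i hi => hβ i (hIcc hi))
    have hpos := hβpos _ hk2
    have hK0 : 0 ≤ ((iterSum B (k + 1)).card : ℝ) / β (k + 1) := by positivity
    have hstep := card_add_iterSum_succ_le (A := A) hB hK0 fun C hC =>
      card_iterSum_le_of_subset hC k.succ_pos hpos (hβ _ hk2)
    have hgrow := mul_le_mul_of_nonneg_right (sub_le_sub_right hAB (A.card : ℝ)) hK0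
    rw [Finset.sum_Icc_succ_top (by omega)]
    linarith
end

section
/- Let $A$, $B$ be finite non-empty sets in a commutative group and for each positive integer $i$ define $D_i = \min_{\emptyset \ne Z \subseteq A} |Z + iB|/|Z|$ (a rational number). Then the sequence $D_i^{1/i}$ is decreasing: for all positive integers $i \le j$ one has $D_j^{\,i} \le D_i^{\,j}$. -/
open Pointwise

open Finset in
lemma sum_eq_sum_range_card_lt {α : Type*} (s : Finset α) (u : α → ℕ) {T : ℕ}
    (hu : ∀ x ∈ s, u x ≤ T) : ∑ x ∈ s, u x = ∑ t ∈ range T, #{x ∈ s | t < u x} := by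
  simp_rw [card_filter]
  rw [sum_comm]
  refine sum_congr rfl fun x hx => ?_
  rw [← card_filter]
  have : {t ∈ range T | t < u x} = range (u x) := by
    ext t
    have := hu x hx
    simp only [mem_filter, mem_range]
    omega
  rw [this, card_range]

open Finset in
/-- If every `Z ⊆ X` has at least `a * #Z` neighbours in `Y` and `f ≤ g` along edges, then
`a * ∑ f ≤ ∑ g`. -/
lemma mul_sum_le_sum_of_mul_card_le_card_neighbors {α β : Type*}
    (X : Finset α) (Y : Finset β) (r : α → β → Prop) (f : α → ℕ) (g : β → ℕ) (a : ℝ)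
    (hfg : ∀ x ∈ X, ∀ y ∈ Y, r x y → f x ≤ g y)
    (hexp : ∀ Z ⊆ X, ∃ W ⊆ Y, (∀ y ∈ W, ∃ x ∈ Z, r x y) ∧ a * (#Z : ℝ) ≤ #W) :
    a * ∑ x ∈ X, (f x : ℝ) ≤ ∑ y ∈ Y, (g y : ℝ) := by
  obtain ⟨T, hTf, hTg⟩ : ∃ T : ℕ, (∀ x ∈ X, f x ≤ T) ∧ ∀ y ∈ Y, g y ≤ T :=
    ⟨X.sup f + Y.sup g, fun x hx => (le_sup (f := f) hx).trans (Nat.le_add_right _ _),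
      fun y hy => (le_sup (f := g) hy).trans (Nat.le_add_left _ _)⟩
  have hf := sum_eq_sum_range_card_lt X f hTf
  have hg := sum_eq_sum_range_card_lt Y g hTg
  have hf' : ∑ x ∈ X, (f x : ℝ) = ∑ t ∈ range T, (#{x ∈ X | t < f x} : ℝ) := by
    exact_mod_cast hf
  have hg' : ∑ y ∈ Y, (g y : ℝ) = ∑ t ∈ range T, (#{y ∈ Y | t < g y} : ℝ) := by
    exact_mod_cast hg
  rw [hf', hg', mul_sum]
  refine sum_le_sum fun t _ => ?_
  obtain ⟨W, hWY, hW, hcard⟩ := hexp {x ∈ X | t < f x} (filter_subset _ _)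
  refine hcard.trans ?_
  norm_cast
  refine card_le_card fun y hy => ?_
  obtain ⟨x, hx, hxy⟩ := hW y hy
  rw [mem_filter] at hx ⊢
  exact ⟨hWY hy, hx.2.trans_le (hfg x hx.1 y (hWY hy) hxy)⟩

/-- The total weight of `S`, where a vertex in layer `k` has weight `c ^ k`. -/
def layerWeight {α : Type*} (c : ℝ) (S : Finset (ℕ × α)) : ℝ := ∑ p ∈ S, c ^ p.1

lemma layerWeight_mono {α : Type*} {c : ℝ} (hc : 0 ≤ c) {S T : Finset (ℕ × α)} (h : S ⊆ T) :
    layerWeight c S ≤ layerWeight c T :=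
  Finset.sum_le_sum_of_subset_of_nonneg h fun _ _ _ => pow_nonneg hc _

lemma layerWeight_layer {α : Type*} (c : ℝ) (k : ℕ) (Z : Finset α) :
    layerWeight c ({k} ×ˢ Z) = Z.card * c ^ k := by
  simp [layerWeight]

lemma layerWeight_union_le {α : Type*} [DecidableEq α] {c : ℝ} (hc : 0 ≤ c)
    (S T : Finset (ℕ × α)) :
    layerWeight c (S ∪ T) ≤ layerWeight c S + layerWeight c T := by
  unfold layerWeight
  rw [← Finset.sum_union_inter]
  exact le_add_of_nonneg_right (Finset.sum_nonneg fun _ _ => pow_nonneg hc _)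

lemma layerWeight_replace_le {α : Type*} [DecidableEq α] {c : ℝ} (hc : 0 ≤ c)
    {S : Finset (ℕ × α)} {k : ℕ} {Z : Finset α}
    (hZ : {k} ×ˢ Z ⊆ S) (l : ℕ) (W : Finset α) :
    layerWeight c ((S \ ({k} ×ˢ Z)) ∪ {l} ×ˢ W)
      ≤ layerWeight c S - Z.card * c ^ k + W.card * c ^ l := by
  refine (layerWeight_union_le hc _ _).trans ?_
  have h : layerWeight c (S \ ({k} ×ˢ Z)) + layerWeight c ({k} ×ˢ Z) = layerWeight c S :=
    Finset.sum_sdiff hZ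
  rw [layerWeight_layer] at h ⊢
  linarith

section

variable {G : Type*} [AddCommGroup G] [DecidableEq G]

open Finset in
/-- The commutativity step: if each two-step path from `P` to `N` has its midpoint in `M`, and
`M` expands by `c⁻¹` into `N` and by `c` backwards into `P`, then `N` has at most `c⁻¹ * #M`
elements reachable from `M`. -/
lemma mul_card_le_card_of_two_step_paths (B M P N : Finset G) {c : ℝ} (hc : 0 < c)
    (hmid : ∀ w ∈ P, ∀ v ∈ N, ∀ u, u - w ∈ B → v - u ∈ B → u ∈ M)
    (hN : ∀ v ∈ N, ∃ u ∈ M, v - u ∈ B)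
    (hout : ∀ Z ⊆ M, (#Z : ℝ) ≤ c * #{v ∈ N | ∃ z ∈ Z, v - z ∈ B})
    (hin : ∀ Z ⊆ M, c * (#Z : ℝ) ≤ #{w ∈ P | ∃ z ∈ Z, z - w ∈ B}) :
    c * (#N : ℝ) ≤ #M := by
  have h_in_le : ∀ u ∈ M, ∀ v ∈ N, v - u ∈ B →
      #{w ∈ P | u - w ∈ B} ≤ #{s ∈ M | v - s ∈ B} := by
    intro u hu v hv huv
    refine card_le_card_of_injOn (fun w => w + (v - u)) ?_ (by intro a _ b _ hab; simpa using hab)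
    intro w hw
    simp only [coe_filter, Set.mem_ofPred_eq] at hw ⊢
    have e1 : v - (w + (v - u)) = u - w := by abel
    have e2 : w + (v - u) - w = v - u := by abel
    rw [e1]
    exact ⟨hmid w hw.1 v hv _ (by rwa [e2]) (by rw [e1]; exact hw.2), hw.2⟩
  have h_out_le : ∀ u ∈ M, ∀ w ∈ P, u - w ∈ B →
      #{v ∈ N | v - u ∈ B} ≤ #{s ∈ M | s - w ∈ B} := by
    intro u hu w hw huw
    refine card_le_card_of_injOn (fun v => v - (u - w)) ?_ (by intro a _ b _ hab; simpa using hab)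
    intro v hv
    simp only [coe_filter, Set.mem_ofPred_eq] at hv ⊢
    have e1 : v - (u - w) - w = v - u := by abel
    have e2 : v - (v - (u - w)) = u - w := by abel
    rw [e1]
    exact ⟨hmid w hw v hv.1 _ (by rw [e1]; exact hv.2) (by rwa [e2]), hv.2⟩
  have hM_pos : ∀ u ∈ M, 1 ≤ #{w ∈ P | u - w ∈ B} := by
    intro u hu
    have h := hin {u} (by simpa using hu)
    simp only [card_singleton, Nat.cast_one, mul_one, mem_singleton, exists_eq_left] at h
    have : (0 : ℝ) < #{w ∈ P | u - w ∈ B} := hc.trans_le h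
    exact_mod_cast this
  have hN_pos : ∀ v ∈ N, 1 ≤ #{s ∈ M | v - s ∈ B} := by
    intro v hv
    obtain ⟨u, hu, huv⟩ := hN v hv
    exact card_pos.2 ⟨u, mem_filter.2 ⟨hu, huv⟩⟩
  have count_out : ∑ u ∈ M, (#{v ∈ N | v - u ∈ B} : ℝ) = ∑ v ∈ N, (#{s ∈ M | v - s ∈ B} : ℝ) := by
    exact_mod_cast sum_card_bipartiteAbove_eq_sum_card_bipartiteBelow (fun u v => v - u ∈ B)
  have count_in : ∑ u ∈ M, (#{w ∈ P | u - w ∈ B} : ℝ) = ∑ w ∈ P, (#{s ∈ M | s - w ∈ B} : ℝ) := by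
    exact_mod_cast sum_card_bipartiteAbove_eq_sum_card_bipartiteBelow (fun u w => u - w ∈ B)
  have h1 := mul_sum_le_sum_of_mul_card_le_card_neighbors M P (fun u w => u - w ∈ B)
    (fun u => #{v ∈ N | v - u ∈ B}) (fun w => #{s ∈ M | s - w ∈ B}) c h_out_le
    (fun Z hZ => ⟨_, filter_subset _ _, fun _ hy => (mem_filter.1 hy).2, hin Z hZ⟩)
  have h2 := mul_sum_le_sum_of_mul_card_le_card_neighbors M N (fun u v => v - u ∈ B)
    (fun u => #{w ∈ P | u - w ∈ B} - 1) (fun v => #{s ∈ M | v - s ∈ B} - 1) c⁻¹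
    (fun u hu v hv huv => Nat.sub_le_sub_right (h_in_le u hu v hv huv) 1)
    (fun Z hZ => ⟨_, filter_subset _ _, fun _ hy => (mem_filter.1 hy).2, by
      rw [inv_mul_le_iff₀ hc]
      exact hout Z hZ⟩)
  have e1 : ∑ u ∈ M, ((#{w ∈ P | u - w ∈ B} - 1 : ℕ) : ℝ)
      = ∑ u ∈ M, (#{w ∈ P | u - w ∈ B} : ℝ) - #M := by
    rw [sum_congr rfl fun u hu => Nat.cast_sub (hM_pos u hu)]
    simp
  have e2 : ∑ v ∈ N, ((#{s ∈ M | v - s ∈ B} - 1 : ℕ) : ℝ)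
      = ∑ v ∈ N, (#{s ∈ M | v - s ∈ B} : ℝ) - #N := by
    rw [sum_congr rfl fun v hv => Nat.cast_sub (hN_pos v hv)]
    simp
  rw [e1, e2, inv_mul_le_iff₀ hc, ← count_out] at h2
  rw [← count_in] at h1
  linarith

/-- `x` is an infinite path in the addition graph, starting in `A` and with steps in `B`. -/
def IsAdditionPath (A B : Finset G) (x : ℕ → G) : Prop :=
  x 0 ∈ A ∧ ∀ k, x (k + 1) - x k ∈ B

/-- Each path in the addition graph meets `S` in one of the layers `0, …, h`. -/
def Separates (A B : Finset G) (h : ℕ) (S : Finset (ℕ × G)) : Prop :=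
  ∀ x, IsAdditionPath A B x → ∃ k ≤ h, (k, x k) ∈ S

lemma sub_mem_iterSum {B : Finset G} {x : ℕ → G} (hx : ∀ k, x (k + 1) - x k ∈ B) (k : ℕ) :
    x k - x 0 ∈ iterSum B k := by
  induction k with
  | zero => simp [iterSum]
  | succ k ih =>
    have e : x (k + 1) - x 0 = (x k - x 0) + (x (k + 1) - x k) := by abel
    rw [e]
    exact Finset.add_mem_add ih (hx k)

lemma exists_path_of_mem_iterSum {B : Finset G} (hB : B.Nonempty) (z : G) (k : ℕ) :
    ∀ g ∈ iterSum B k, ∃ x : ℕ → G, x 0 = z ∧ (∀ t, x (t + 1) - x t ∈ B) ∧ x k = z + g := by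
  induction k with
  | zero =>
    intro g hg
    obtain ⟨b, hb⟩ := hB
    simp only [iterSum, Finset.mem_singleton] at hg
    exact ⟨fun t => z + t • b, by simp, fun t => by simpa [succ_nsmul] using hb, by simp [hg]⟩
  | succ k ih =>
    intro g hg
    obtain ⟨g', hg', b, hb, rfl⟩ := Finset.mem_add.1 hg
    obtain ⟨x, hx0, hx, hxk⟩ := ih g' hg'
    refine ⟨fun t => if t ≤ k then x t else x k + (t - k) • b, by simpa using hx0, ?_, ?_⟩
    · intro t
      rcases lt_trichotomy t k with h | rfl | h
      · simpa [Nat.succ_le_of_lt h, h.le] using hx t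
      · simpa using hb
      · have e : t + 1 - k = (t - k) + 1 := by omega
        simpa [show ¬ t + 1 ≤ k by omega, show ¬ t ≤ k by omega, e, succ_nsmul] using hb
    · simp [hxk, add_assoc]

/-- In a separating set of minimal weight, an intermediate layer can be pushed to the next one. -/
lemma exists_separates_push_layer {A B : Finset G} {h : ℕ} {c : ℝ} (hc : 0 < c)
    {S : Finset (ℕ × G)} (hS : Separates A B h S)
    (hmin : ∀ T, Separates A B h T → layerWeight c S ≤ layerWeight c T) {n : ℕ} (hn : n + 1 < h) :
    ∃ T, Separates A B h T ∧ layerWeight c T ≤ layerWeight c S ∧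
      (∀ g, (n + 1, g) ∉ T) ∧ ∀ k ≤ n, ∀ g, (k, g) ∈ T → (k, g) ∈ S := by
  classical
  set M : Finset G := (S.filter fun p => p.1 = n + 1).image Prod.snd with hM
  have mem_M : ∀ g, g ∈ M ↔ (n + 1, g) ∈ S := by
    intro g
    simp [hM]
  set Pp : G → Prop := fun w =>
    ∃ x, IsAdditionPath A B x ∧ x n = w ∧ ∀ k ≤ n, (k, x k) ∉ S with hPp
  set Np : G → Prop := fun v => ∃ y : ℕ → G, (∀ k, y (k + 1) - y k ∈ B) ∧ y (n + 2) = v ∧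
    ∀ k, n + 2 ≤ k → k ≤ h → (k, y k) ∉ S with hNp
  have sub_S : ∀ Z ⊆ M, {n + 1} ×ˢ Z ⊆ S := by
    rintro Z hZ ⟨k, g⟩ hp
    simp only [Finset.mem_product, Finset.mem_singleton] at hp
    obtain ⟨rfl, hg⟩ := hp
    exact (mem_M g).1 (hZ hg)
  have sep_of : ∀ (Z : Finset G) (l : ℕ) (W : Finset G), l ≤ h →
      (∀ x, IsAdditionPath A B x → x (n + 1) ∈ Z → (∀ k ≤ h, k ≠ n + 1 → (k, x k) ∉ S) →
        x l ∈ W) → Separates A B h ((S \ ({n + 1} ×ˢ Z)) ∪ {l} ×ˢ W) := by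
    intro Z l W hl hW x hx
    by_cases hex : ∃ k ≤ h, (k, x k) ∈ S \ ({n + 1} ×ˢ Z)
    · obtain ⟨k, hk, hmem⟩ := hex
      exact ⟨k, hk, Finset.mem_union_left _ hmem⟩
    · push Not at hex
      have key : ∀ k ≤ h, (k, x k) ∈ S → k = n + 1 ∧ x k ∈ Z := by
        intro k hk hkS
        have := hex k hk
        simp only [Finset.mem_sdiff, Finset.mem_product, Finset.mem_singleton] at this
        tauto
      obtain ⟨k, hk, hkS⟩ := hS x hx
      obtain ⟨rfl, hxZ⟩ := key k hk hkS
      refine ⟨l, hl, Finset.mem_union_right _ ?_⟩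
      simp only [Finset.mem_product, Finset.mem_singleton, true_and]
      exact hW x hx hxZ fun k hk hne hkS => hne (key k hk hkS).1
  set N : Finset G := (M + B).filter Np with hN
  set P : Finset G := (M - B).filter Pp with hP
  have sep_out : ∀ Z ⊆ M, Separates A B h
      ((S \ ({n + 1} ×ˢ Z)) ∪ {n + 2} ×ˢ (N.filter fun v => ∃ z ∈ Z, v - z ∈ B)) := by
    intro Z hZ
    refine sep_of Z _ _ hn fun x hx hxZ hxS => ?_
    have hstep := hx.2 (n + 1)
    simp only [hN, Finset.mem_filter]
    refine ⟨⟨Finset.mem_add.2 ⟨_, hZ hxZ, _, hstep, by abel⟩, x, hx.2, rfl, ?_⟩, _, hxZ, hstep⟩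
    intro k hk hkh
    exact hxS k hkh (by omega)
  have sep_in : ∀ Z ⊆ M, Separates A B h
      ((S \ ({n + 1} ×ˢ Z)) ∪ {n} ×ˢ (P.filter fun w => ∃ z ∈ Z, z - w ∈ B)) := by
    intro Z hZ
    refine sep_of Z _ _ (by omega) fun x hx hxZ hxS => ?_
    have hstep := hx.2 n
    simp only [hP, Finset.mem_filter]
    refine ⟨⟨Finset.mem_sub.2 ⟨_, hZ hxZ, _, hstep, by abel⟩, x, hx, rfl, ?_⟩, _, hxZ, hstep⟩
    intro k hk
    exact hxS k (by omega) (by omega)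
  have hcn : 0 < c ^ n := pow_pos hc n
  have hcard : c * (N.card : ℝ) ≤ M.card := by
    refine mul_card_le_card_of_two_step_paths B M P N hc ?_ ?_ ?_ ?_
    · intro w hw v hv u hwu huv
      obtain ⟨x, hx, hxw, hxS⟩ := (Finset.mem_filter.1 hw).2
      obtain ⟨y, hy, hyv, hyS⟩ := (Finset.mem_filter.1 hv).2
      obtain ⟨k, hk, hkS⟩ :=
        hS (fun k => if k ≤ n then x k else if k = n + 1 then u else y k) (by
          refine ⟨by simpa using hx.1, fun k => ?_⟩
          rcases lt_trichotomy k n with hkn | rfl | hkn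
          · simpa [Nat.succ_le_of_lt hkn, hkn.le] using hx.2 k
          · simpa [hxw] using hwu
          · obtain rfl | hkn' : k = n + 1 ∨ n + 1 < k := by omega
            · simpa [hyv] using huv
            · simpa [show ¬ k + 1 ≤ n by omega, show ¬ k ≤ n by omega,
                show k ≠ n by omega, show k ≠ n + 1 by omega] using hy k)
      by_cases h1 : k ≤ n
      · simp only [h1, if_true] at hkS
        exact absurd hkS (hxS k h1)
      · by_cases h2 : k = n + 1
        · subst h2
          simp only [h1, if_true, if_false] at hkS
          exact (mem_M u).2 hkS
        · simp only [h1, h2, if_false] at hkS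
          exact absurd hkS (hyS k (by omega) hk)
    · intro v hv
      obtain ⟨u, hu, b, hb, rfl⟩ := Finset.mem_add.1 (Finset.mem_filter.1 hv).1
      exact ⟨u, hu, by simpa using hb⟩
    · intro Z hZ
      have h1 := (hmin _ (sep_out Z hZ)).trans (layerWeight_replace_le hc.le (sub_S Z hZ) _ _)
      refine le_of_mul_le_mul_right (a := c ^ (n + 1)) ?_ (pow_pos hc _)
      rw [pow_succ c (n + 1)] at h1
      linarith
    · intro Z hZ
      have h1 := (hmin _ (sep_in Z hZ)).trans (layerWeight_replace_le hc.le (sub_S Z hZ) _ _)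
      refine le_of_mul_le_mul_right (a := c ^ n) ?_ hcn
      rw [pow_succ] at h1
      linarith
  refine ⟨_, sep_out M subset_rfl, ?_, ?_, ?_⟩
  · refine (layerWeight_replace_le hc.le (sub_S M subset_rfl) _ _).trans ?_
    have h1 : ((N.filter fun v => ∃ z ∈ M, v - z ∈ B).card : ℝ) ≤ N.card := by
      exact_mod_cast Finset.card_filter_le _ _
    have h2 := mul_le_mul_of_nonneg_right
      ((mul_le_mul_of_nonneg_left h1 hc.le).trans hcard) (pow_pos hc (n + 1)).le
    rw [pow_succ c (n + 1)]
    linarith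
  · intro g hg
    simp only [Finset.mem_union, Finset.mem_sdiff, Finset.mem_product, Finset.mem_singleton] at hg
    rcases hg with ⟨hgS, hgM⟩ | ⟨h1, -⟩
    · exact hgM ⟨trivial, (mem_M g).2 hgS⟩
    · omega
  · intro k hk g hg
    simp only [Finset.mem_union, Finset.mem_sdiff, Finset.mem_product, Finset.mem_singleton] at hg
    rcases hg with ⟨hgS, -⟩ | ⟨h1, -⟩
    · exact hgS
    · omega

lemma exists_separates_min (A B : Finset G) (h : ℕ) {c : ℝ} (hc : 0 < c) :
    ∃ S, Separates A B h S ∧ ∀ T, Separates A B h T → layerWeight c S ≤ layerWeight c T := by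
  classical
  set U : Finset (ℕ × G) :=
    (Finset.range (h + 1)).biUnion fun k => {k} ×ˢ (A + iterSum B k) with hU
  have mem_U : ∀ x, IsAdditionPath A B x → ∀ k ≤ h, (k, x k) ∈ U := by
    intro x hx k hk
    simp only [hU, Finset.mem_biUnion, Finset.mem_range, Finset.mem_product, Finset.mem_singleton]
    exact ⟨k, by omega, rfl, Finset.mem_add.2 ⟨_, hx.1, _, sub_mem_iterSum hx.2 k, by abel⟩⟩
  have sep_inter : ∀ T, Separates A B h T → Separates A B h (U ∩ T) := by
    intro T hT x hx
    obtain ⟨k, hk, hkT⟩ := hT x hx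
    exact ⟨k, hk, Finset.mem_inter.2 ⟨mem_U x hx k hk, hkT⟩⟩
  have hne : (U.powerset.filter (Separates A B h)).Nonempty :=
    ⟨U, by
      simp only [Finset.mem_filter, Finset.mem_powerset, subset_rfl, true_and]
      exact fun x hx => ⟨0, Nat.zero_le _, mem_U x hx 0 (Nat.zero_le _)⟩⟩
  obtain ⟨S, hS, hmin⟩ := Finset.exists_min_image _ (layerWeight c) hne
  refine ⟨S, (Finset.mem_filter.1 hS).2, fun T hT => ?_⟩
  refine (hmin (U ∩ T) ?_).trans (layerWeight_mono hc.le Finset.inter_subset_right)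
  simp only [Finset.mem_filter, Finset.mem_powerset]
  exact ⟨Finset.inter_subset_left, sep_inter T hT⟩

/-- Some separating set of minimal weight lies in the first and last layers. -/
lemma exists_separates_min_outer_layers (A B : Finset G) (h : ℕ) {c : ℝ} (hc : 0 < c) :
    ∃ S, Separates A B h S ∧ (∀ T, Separates A B h T → layerWeight c S ≤ layerWeight c T) ∧
      ∀ k, 0 < k → k < h → ∀ g, (k, g) ∉ S := by
  suffices H : ∀ n, n < h → ∃ S, Separates A B h S ∧
      (∀ T, Separates A B h T → layerWeight c S ≤ layerWeight c T) ∧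
      ∀ k, 0 < k → k ≤ n → ∀ g, (k, g) ∉ S by
    rcases Nat.eq_zero_or_pos h with rfl | hh
    · obtain ⟨S, hS, hmin⟩ := exists_separates_min A B 0 hc
      exact ⟨S, hS, hmin, fun k _ hk => absurd hk (Nat.not_lt_zero k)⟩
    · obtain ⟨S, hS, hmin, hS'⟩ := H (h - 1) (by omega)
      exact ⟨S, hS, hmin, fun k hk hkh => hS' k hk (by omega)⟩
  intro n
  induction n with
  | zero =>
    intro _
    obtain ⟨S, hS, hmin⟩ := exists_separates_min A B h hc
    exact ⟨S, hS, hmin, fun k hk hk' => by omega⟩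
  | succ n ih =>
    intro hn
    obtain ⟨S, hS, hmin, hS'⟩ := ih (by omega)
    obtain ⟨T, hT, hTS, hTn, hTk⟩ := exists_separates_push_layer hc hS hmin hn
    refine ⟨T, hT, fun T' hT' => hTS.trans (hmin T' hT'), fun k hk hkn g hg => ?_⟩
    obtain rfl | hlt : k = n + 1 ∨ k ≤ n := by omega
    · exact hTn g hg
    · exact hS' k hk hlt g (hTk k hlt g hg)

/-- Expansion of all subsets of `A` by `c⁻¹ ^ h` under `h • B` forces expansion by `c⁻¹ ^ i` under
`i • B` for each `i ≤ h`. -/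
lemma card_le_pow_mul_card_add_iterSum {A B : Finset G} (hB : B.Nonempty) {h i : ℕ} (hh : 0 < h)
    (hih : i ≤ h) {c : ℝ} (hc : 0 < c)
    (hexp : ∀ Z ⊆ A, (Z.card : ℝ) ≤ (Z + iterSum B h).card * c ^ h) {Z : Finset G} (hZ : Z ⊆ A) :
    (Z.card : ℝ) ≤ (Z + iterSum B i).card * c ^ i := by
  classical
  obtain ⟨S, hS, hmin, hmid⟩ := exists_separates_min_outer_layers A B h hc
  set Y : Finset G := A.filter fun a => (0, a) ∉ S with hY
  have hYS : {0} ×ˢ (A \ Y) ∪ {h} ×ˢ (Y + iterSum B h) ⊆ S := by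
    rintro ⟨k, g⟩ hp
    simp only [Finset.mem_union, Finset.mem_product, Finset.mem_singleton] at hp
    rcases hp with ⟨rfl, hg⟩ | ⟨rfl, hg⟩
    · simp only [hY, Finset.mem_sdiff, Finset.mem_filter] at hg
      tauto
    · obtain ⟨z, hz, g', hg', rfl⟩ := Finset.mem_add.1 hg
      obtain ⟨hzA, hzS⟩ := Finset.mem_filter.1 hz
      obtain ⟨x, hx0, hx, hxk⟩ := exists_path_of_mem_iterSum hB z k g' hg'
      obtain ⟨l, hl, hlS⟩ := hS x ⟨by rwa [hx0], hx⟩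
      rcases Nat.eq_zero_or_pos l with rfl | hl0
      · rw [hx0] at hlS
        exact absurd hlS hzS
      · rcases hl.lt_or_eq with hlt | rfl
        · exact absurd hlS (hmid l hl0 hlt _)
        · rwa [hxk] at hlS
  have hdisj : Disjoint ({0} ×ˢ (A \ Y)) ({h} ×ˢ (Y + iterSum B h)) := by
    rw [Finset.disjoint_left]
    rintro ⟨k, g⟩ h1 h2
    simp only [Finset.mem_product, Finset.mem_singleton] at h1 h2
    omega
  have hlow : (A.card : ℝ) ≤ layerWeight c S := by
    refine le_trans ?_ (layerWeight_mono hc.le hYS)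
    have e : layerWeight c ({0} ×ˢ (A \ Y) ∪ {h} ×ˢ (Y + iterSum B h))
        = layerWeight c ({0} ×ˢ (A \ Y)) + layerWeight c ({h} ×ˢ (Y + iterSum B h)) :=
      Finset.sum_union hdisj
    rw [e, layerWeight_layer, layerWeight_layer, pow_zero, mul_one]
    have h1 := hexp Y (Finset.filter_subset _ _)
    have h2 : ((A \ Y).card : ℝ) + Y.card = A.card := by
      exact_mod_cast Finset.card_sdiff_add_card_eq_card (Finset.filter_subset _ A)
    linarith
  have hsep : Separates A B h ({0} ×ˢ (A \ Z) ∪ {i} ×ˢ (Z + iterSum B i)) := by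
    intro x hx
    by_cases hxZ : x 0 ∈ Z
    · refine ⟨i, hih, Finset.mem_union_right _ ?_⟩
      simp only [Finset.mem_product, Finset.mem_singleton, true_and]
      exact Finset.mem_add.2 ⟨_, hxZ, _, sub_mem_iterSum hx.2 i, by abel⟩
    · refine ⟨0, Nat.zero_le _, Finset.mem_union_left _ ?_⟩
      simp only [Finset.mem_product, Finset.mem_singleton, true_and, Finset.mem_sdiff]
      exact ⟨hx.1, hxZ⟩
  have hup := (hlow.trans (hmin _ hsep)).trans (layerWeight_union_le hc.le _ _)
  rw [layerWeight_layer, layerWeight_layer, pow_zero, mul_one] at hup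
  have h2 : ((A \ Z).card : ℝ) + Z.card = A.card := by
    exact_mod_cast Finset.card_sdiff_add_card_eq_card hZ
  linarith

lemma iterSum_nonempty {B : Finset G} (hB : B.Nonempty) (k : ℕ) : (iterSum B k).Nonempty := by
  induction k with
  | zero => exact Finset.singleton_nonempty 0
  | succ k ih => exact ih.add hB

end

/-- Plünnecke's inequality on addition graphs: with
`D i = min_{∅ ≠ Z ⊆ A} |Z + iB| / |Z|`, the sequence `(D i)^(1/i)` is decreasing,
i.e. `D j ^ i ≤ D i ^ j` for `i ≤ j`. -/
theorem stmt_6 {G : Type*} [AddCommGroup G] [DecidableEq G]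
    (A B : Finset G) (hA : A.Nonempty) (hB : B.Nonempty)
    (i j : ℕ) (hi : 0 < i) (hij : i ≤ j) (Di Dj : ℚ)
    (hDi : IsLeast {r : ℚ | ∃ Z ⊆ A, Z.Nonempty ∧
        r = ((Z + iterSum B i).card : ℚ) / (Z.card : ℚ)} Di)
    (hDj : IsLeast {r : ℚ | ∃ Z ⊆ A, Z.Nonempty ∧
        r = ((Z + iterSum B j).card : ℚ) / (Z.card : ℚ)} Dj) :
    Dj ^ i ≤ Di ^ j := by
  obtain ⟨X, hXA, hX, rfl⟩ := hDi.1
  obtain ⟨Y, hYA, hY, hDjY⟩ := hDj.1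
  have hj : 0 < j := hi.trans_le hij
  have hDj_pos : 0 < Dj := by
    rw [hDjY]
    have h1 := (hY.add (iterSum_nonempty hB j)).card_pos
    have h2 := hY.card_pos
    positivity
  have hDj_pos' : (0 : ℝ) < Dj := by exact_mod_cast hDj_pos
  set d : ℝ := (Dj : ℝ) ^ ((j : ℝ)⁻¹) with hd
  have hd_pos : 0 < d := Real.rpow_pos_of_pos hDj_pos' _
  have hdj : d ^ j = Dj := Real.rpow_inv_natCast_pow hDj_pos'.le hj.ne'
  have hexp : ∀ Z ⊆ A, (Z.card : ℝ) ≤ (Z + iterSum B j).card * d⁻¹ ^ j := by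
    intro Z hZ
    rcases Z.eq_empty_or_nonempty with rfl | hne
    · simp
    · have h1 : (Dj : ℝ) ≤ ((Z + iterSum B j).card : ℝ) / Z.card := by
        have h2 := Rat.cast_le (K := ℝ).2 (hDj.2 ⟨Z, hZ, hne, rfl⟩)
        push_cast at h2
        exact h2
      have hZ_pos : (0 : ℝ) < Z.card := by exact_mod_cast hne.card_pos
      rw [inv_pow, hdj, ← div_eq_mul_inv, le_div_iff₀ hDj_pos', mul_comm]
      exact (le_div_iff₀ hZ_pos).1 h1
  have hX_le := card_le_pow_mul_card_add_iterSum hB hj hij (inv_pos.2 hd_pos) hexp hXA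
  have hX_pos : (0 : ℝ) < X.card := by exact_mod_cast hX.card_pos
  have hdi : d ^ i ≤ ((X + iterSum B i).card : ℝ) / X.card := by
    rw [inv_pow, ← div_eq_mul_inv, le_div_iff₀ (pow_pos hd_pos i)] at hX_le
    rw [le_div_iff₀ hX_pos]
    linarith
  have key : (Dj : ℝ) ^ i ≤ (((X + iterSum B i).card : ℝ) / X.card) ^ j := by
    rw [← hdj, ← pow_mul, mul_comm, pow_mul]
    exact pow_le_pow_left₀ (pow_pos hd_pos i).le hdi j
  rw [← Rat.cast_le (K := ℝ)]
  push_cast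
  exact key
end

section
/- Let $B$ and $C$ be finite sets in a commutative group with $B$ non-empty, let $a$ be an element of the group, and let $h$ be a positive integer. Then $|(\{a\} + hB) \setminus (C + (h-1)B)| \le \binom{|(\{a\}+B) \setminus C| + h - 1}{h}$. -/
open Pointwise

theorem mem_iterSum {G : Type*} [AddCommGroup G] [DecidableEq G] {B : Finset G} {k : ℕ} {x : G} :
    x ∈ iterSum B k ↔ ∃ s : Multiset G, s.card = k ∧ (∀ b ∈ s, b ∈ B) ∧ s.sum = x := by
  induction k generalizing x with
  | zero =>
    constructor
    · intro hx
      exact ⟨0, by simp, by simp, by simpa [iterSum, eq_comm] using hx⟩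
    · rintro ⟨s, hs, -, rfl⟩
      simp [iterSum, Multiset.card_eq_zero.mp hs]
  | succ k ih =>
    rw [iterSum, Finset.mem_add]
    constructor
    · rintro ⟨y, hy, b, hb, rfl⟩
      obtain ⟨s, hs, hsB, rfl⟩ := ih.mp hy
      refine ⟨b ::ₘ s, by simp [hs], ?_, by simp [add_comm]⟩
      simpa using ⟨hb, hsB⟩
    · rintro ⟨s, hs, hsB, rfl⟩
      obtain ⟨b, hb⟩ := Multiset.card_pos_iff_exists_mem.mp (by omega : 0 < s.card)
      obtain ⟨t, rfl⟩ := Multiset.exists_cons_of_mem hb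
      refine ⟨t.sum, ih.mpr ⟨t, by simpa using hs, fun c hc => hsB c (by simp [hc]), rfl⟩,
        b, hsB b hb, by simp [add_comm]⟩

/-- In a restricted addition graph, single vertices expand polynomially:
`|({a} + hB) \ (C + (h-1)B)| ≤ C(|({a}+B) \ C| + h - 1, h)`. -/
theorem stmt_9 {G : Type*} [AddCommGroup G] [DecidableEq G]
    (B C : Finset G) (hB : B.Nonempty) (a : G) (h : ℕ) (hh : 0 < h) :
    ((({a} : Finset G) + iterSum B h) \ (C + iterSum B (h - 1))).card ≤
      Nat.choose (((({a} : Finset G) + B) \ C).card + h - 1) h := by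
  set D := (({a} : Finset G) + B) \ C
  let f : Sym D h → G := fun s => a + ((s : Multiset D).map fun d : D => (d : G) - a).sum
  have hsub : (({a} : Finset G) + iterSum B h) \ (C + iterSum B (h - 1)) ⊆
      Finset.univ.image f := by
    intro x hx
    obtain ⟨hx, hxC⟩ := Finset.mem_sdiff.mp hx
    rw [Finset.singleton_add, Finset.mem_vadd_finset] at hx
    obtain ⟨y, hy, rfl⟩ := hx
    obtain ⟨s, hs, hsB, rfl⟩ := mem_iterSum.mp hy
    have hsD : ∀ b ∈ s, a + b ∈ D := by
      intro b hb
      refine Finset.mem_sdiff.mpr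
        ⟨Finset.add_mem_add (Finset.mem_singleton_self _) (hsB b hb), fun hbC => hxC ?_⟩
      obtain ⟨t, rfl⟩ := Multiset.exists_cons_of_mem hb
      rw [vadd_eq_add, Multiset.sum_cons, ← add_assoc]
      refine Finset.add_mem_add hbC (mem_iterSum.mpr ⟨t, ?_, fun c hc => hsB c (by simp [hc]), rfl⟩)
      rw [← hs, Multiset.card_cons, Nat.add_sub_cancel]
    refine Finset.mem_image.mpr
      ⟨⟨s.attach.map fun b : {b // b ∈ s} => ⟨_, hsD b b.2⟩, by simpa using hs⟩, Finset.mem_univ _, ?_⟩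
    have hsum : (s.map fun b => a + b).sum = h • a + s.sum := by
      rw [Multiset.sum_map_add, Multiset.map_const', Multiset.sum_replicate, hs, Multiset.map_id']
    simp [f, Multiset.map_map, hsum]
  calc _ ≤ (Finset.univ.image f).card := Finset.card_le_card hsub
    _ ≤ Fintype.card (Sym D h) := Finset.card_image_le
    _ = _ := by rw [Sym.card_sym_eq_choose, Fintype.card_coe]
end
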